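/- Let f, g ∈ ℂ[z₁,…,zₙ] be nonconstant square-free homogeneous polynomials. If there exists a bi-Lipschitz homeomorphism φ : (ℂⁿ, V(f), 0) → (ℂⁿ, V(g), 0), then f and g have the same number of pairwise non-associated irreducible factors; equivalently, the zero cones V(f) and V(g) have the same number of irreducible components. (The invariance r = s of the number of irreducible components of the tangent cones under bi-Lipschitz homeomorphism.) -/

import Mathlib

noncomputable section

/-- `ℂⁿ` with the Euclidean metric. -/
abbrev En (n : ℕ) := EuclideanSpace ℂ (Fin n)

/-- The zero set `V(p) ⊆ ℂⁿ` of a polynomial `p ∈ ℂ[z₁,…,zₙ]`. -/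
def pV {n : ℕ} (p : MvPolynomial (Fin n) ℂ) : Set (En n) :=
  {x | MvPolynomial.eval (x : Fin n → ℂ) p = 0}

/-- A bi-Lipschitz homeomorphism of germs `φ : (ℂⁿ, X, 0) → (ℂⁿ, Y, 0)`. -/
def BiLipGermHomeo {n : ℕ} (X Y : Set (En n)) : Prop :=
  ∃ (U U' : Set (En n)) (φ ψ : En n → En n) (K : NNReal),
    IsOpen U ∧ IsOpen U' ∧ (0 : En n) ∈ U ∧ (0 : En n) ∈ U' ∧
    φ 0 = 0 ∧
    Set.MapsTo φ U U' ∧ Set.MapsTo ψ U' U ∧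
    Set.LeftInvOn ψ φ U ∧ Set.RightInvOn ψ φ U' ∧
    LipschitzOnWith K φ U ∧ LipschitzOnWith K ψ U' ∧
    φ '' (X ∩ U) = Y ∩ U'

section Aux

open Topology Filter unitInterval

lemma hlog {A : Type*} [TopologicalSpace A] (F : A → I → ℂ)
    (hF : Continuous (fun p : I × A => F p.2 p.1)) (h0 : ∀ a s, F a s ≠ 0)
    (l : A → ℂ) (hl : Continuous l) (hl0 : ∀ a, Complex.exp (l a) = F a 0) :
    ∃ k : A → I → ℂ, Continuous (fun p : I × A => k p.2 p.1) ∧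
      (∀ a s, Complex.exp (k a s) = F a s) ∧ ∀ a, k a 0 = l a := by
  let H : C(I × A, {z : ℂ // z ≠ 0}) := ⟨fun p => ⟨F p.2 p.1, h0 _ _⟩, hF.subtype_mk _⟩
  have H0 : ∀ a, H (0, a) = (fun z : ℂ ↦ (⟨_, z.exp_ne_zero⟩ : {z : ℂ // z ≠ 0})) ((⟨l, hl⟩ : C(A, ℂ)) a) := by
    intro a
    apply Subtype.ext
    simp [H, hl0]
  let K := Complex.isCoveringMap_exp.liftHomotopy H ⟨l, hl⟩ H0
  refine ⟨fun a s => K (s, a), K.continuous, fun a s => ?_, fun a => ?_⟩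
  · have := congrFun (Complex.isCoveringMap_exp.liftHomotopy_lifts H ⟨l, hl⟩ H0) (s, a)
    exact congrArg Subtype.val this
  · exact Complex.isCoveringMap_exp.liftHomotopy_zero H ⟨l, hl⟩ H0 a

lemma log_normed {E : Type*} [NormedAddCommGroup E] [NormedSpace ℝ E] (u : E → ℂ)
    (hu : Continuous u) (h0 : ∀ a, u a ≠ 0) :
    ∃ h : E → ℂ, Continuous h ∧ ∀ a, Complex.exp (h a) = u a := by
  obtain ⟨k, hk, hk1, -⟩ := hlog (fun (a : E) (s : I) => u ((s : ℝ) • a)) (by fun_prop)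
    (fun _ _ => h0 _) (fun _ => Complex.log (u 0)) continuous_const
    (fun a => by simp [Complex.exp_log (h0 0)])
  refine ⟨fun a => k a 1, ?_, fun a => ?_⟩
  · exact hk.comp (f := fun a : E => ((1 : I), a)) (by fun_prop)
  · rw [hk1]; simp

/-- degree of a nonvanishing map of the circle -/
def HasDeg (u : Circle → ℂ) (c : ℤ) : Prop :=
  ∃ h : Circle → ℂ, Continuous h ∧ ∀ z : Circle, u z = (z : ℂ) ^ c * Complex.exp (h z)

lemma int_const {A : Type*} [TopologicalSpace A] [PreconnectedSpace A] (d : A → ℂ)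
    (hd : Continuous d) (h : ∀ a, Complex.exp (d a) = 1) (a b : A) : d a = d b := by
  have hm : ∀ a, ∃ m : ℤ, d a = m * (2 * Real.pi * Complex.I) :=
    fun a => Complex.exp_eq_one_iff.1 (h a)
  choose m hm using hm
  have hpi : (2 * Real.pi : ℝ) ≠ 0 := by positivity
  have hc : Continuous (fun a => (m a : ℝ)) := by
    have : (fun a => (m a : ℝ)) = fun a => (d a).im / (2 * Real.pi) := by
      funext a
      rw [hm a]
      simp
    rw [this]
    fun_prop
  have hc' : Continuous m := by
    rw [Int.isClosedEmbedding_coe_real.isInducing.continuous_iff]; exact hc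
  rw [hm a, hm b, PreconnectedSpace.constant inferInstance hc' (x := a) (y := b)]

lemma exists_deg (u : Circle → ℂ) (hu : Continuous u) (h0 : ∀ z, u z ≠ 0) :
    ∃ c, HasDeg u c := by
  obtain ⟨L, hL, hL1⟩ := log_normed (fun θ : ℝ => u (Circle.exp θ)) (by fun_prop) (fun _ => h0 _)
  obtain ⟨c, hc⟩ : ∃ c : ℤ, L (0 + 2 * Real.pi) - L 0 = c * (2 * Real.pi * Complex.I) := by
    apply Complex.exp_eq_one_iff.1
    rw [Complex.exp_sub, hL1, hL1, Circle.periodic_exp 0, div_self (h0 _)]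
  have hper : ∀ θ, L (θ + 2 * Real.pi) - L θ = c * (2 * Real.pi * Complex.I) := by
    intro θ
    rw [← hc]
    refine int_const (fun θ => L (θ + 2 * Real.pi) - L θ) (by fun_prop) ?_ _ _ |>.trans rfl
    intro a
    rw [Complex.exp_sub, hL1, hL1, Circle.periodic_exp a, div_self (h0 _)]
  have hQ : IsQuotientMap Circle.exp :=
    Circle.isCoveringMap_exp.isQuotientMap (by
      intro z; exact ⟨_, Circle.exp_arg z⟩)
  have hfac : ∀ a b, Circle.exp a = Circle.exp b → L a - c * a * Complex.I = L b - c * b * Complex.I := by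
    intro a b hab
    obtain ⟨m, hm⟩ := Circle.exp_eq_exp.1 hab
    have hp : Function.Periodic (fun θ : ℝ => L θ - c * θ * Complex.I) (2 * Real.pi) := by
      intro θ
      have := hper θ
      beta_reduce
      push_cast
      linear_combination this
    have := hp.int_mul m b
    rw [hm, this]
  refine ⟨c, fun z => L (Complex.arg z) - c * (Complex.arg z) * Complex.I, ?_, ?_⟩
  · rw [hQ.continuous_iff]
    have : ((fun z : Circle => L (Complex.arg z) - c * (Complex.arg z) * Complex.I) ∘ Circle.exp)
      = fun θ : ℝ => L θ - c * θ * Complex.I := by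
      funext θ
      simp only [Function.comp]
      apply hfac
      rw [Circle.exp_arg]
    rw [this]; fun_prop
  · intro z
    rw [Complex.exp_sub, hL1, Circle.exp_arg]
    have : Complex.exp (c * (Complex.arg z) * Complex.I) = (z : ℂ) ^ c := by
      rw [mul_assoc, Complex.exp_int_mul]
      congr 1
      conv_rhs => rw [← Circle.exp_arg z]
      rw [Circle.coe_exp]
    rw [this]
    field_simp

lemma deg_zero_of_exp (c : ℤ) (h : Circle → ℂ) (hh : Continuous h)
    (he : ∀ z : Circle, (z : ℂ) ^ c = Complex.exp (h z)) : c = 0 := by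
  have := int_const (fun θ : ℝ => h (Circle.exp θ) - c * (θ * Complex.I)) (by fun_prop) (by
    intro θ
    rw [Complex.exp_sub, ← he, Complex.exp_int_mul, Circle.coe_exp, div_self]
    exact zpow_ne_zero _ (Complex.exp_ne_zero _)) 0 (0 + 2 * Real.pi)
  rw [Circle.periodic_exp 0] at this
  have h2 : (c : ℂ) * (2 * Real.pi * Complex.I) = 0 := by
    push_cast at this
    linear_combination this
  simpa [Real.pi_ne_zero] using h2

lemma HasDeg.mul {u u' : Circle → ℂ} {c c' : ℤ} (h : HasDeg u c) (h' : HasDeg u' c') :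
    HasDeg (fun z => u z * u' z) (c + c') := by
  obtain ⟨k, hk, hk1⟩ := h
  obtain ⟨k', hk', hk1'⟩ := h'
  refine ⟨fun z => k z + k' z, by fun_prop, fun z => ?_⟩
  beta_reduce
  rw [hk1, hk1', Complex.exp_add, zpow_add₀ (Circle.coe_ne_zero z)]
  ring

lemma HasDeg.zpow {u : Circle → ℂ} {c : ℤ} (h : HasDeg u c) (m : ℤ) :
    HasDeg (fun z => u z ^ m) (m * c) := by
  obtain ⟨k, hk, hk1⟩ := h
  refine ⟨fun z => m * k z, by fun_prop, fun z => ?_⟩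
  beta_reduce
  rw [hk1, Complex.exp_int_mul, mul_zpow, mul_comm m, zpow_mul]

lemma HasDeg.prod {ι : Type*} (s : Finset ι) (u : ι → Circle → ℂ) (c : ι → ℤ)
    (h : ∀ i ∈ s, HasDeg (u i) (c i)) :
    HasDeg (fun z => ∏ i ∈ s, u i z) (∑ i ∈ s, c i) := by
  classical
  induction s using Finset.induction_on with
  | empty => exact ⟨fun _ => 0, continuous_const, by simp⟩
  | insert a s ha ih =>
    simp only [Finset.prod_insert ha, Finset.sum_insert ha]
    exact (h a (by simp)).mul (ih fun i hi => h i (by simp [hi]))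

lemma HasDeg.exp {h : Circle → ℂ} (hh : Continuous h) : HasDeg (fun z => Complex.exp (h z)) 0 :=
  ⟨h, hh, by simp⟩

lemma HasDeg.unique {u : Circle → ℂ} {c c' : ℤ} (h : HasDeg u c) (h' : HasDeg u c') : c = c' := by
  obtain ⟨k, hk, hk1⟩ := h
  obtain ⟨k', hk', hk1'⟩ := h'
  have := deg_zero_of_exp (c - c') (fun z => k' z - k z) (by fun_prop) (by
    intro z
    have hz := Circle.coe_ne_zero z
    rw [zpow_sub₀ hz, Complex.exp_sub, div_eq_div_iff (zpow_ne_zero _ hz) (Complex.exp_ne_zero _),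
      ← hk1, hk1']
    ring)
  omega

lemma HasDeg.near {u u' : Circle → ℂ} {c : ℤ} (h : HasDeg u c) (hu : Continuous u)
    (hu' : Continuous u')
    (hn : ∀ z, ‖u' z - u z‖ < ‖u z‖) : HasDeg u' c := by
  have hne : ∀ z, u z ≠ 0 := fun z hz => by
    have := hn z
    rw [hz, norm_zero] at this
    exact absurd this (not_lt.2 (norm_nonneg _))
  have hs : ∀ z, u' z / u z ∈ Complex.slitPlane := by
    intro z
    have h1 : ‖u' z / u z - 1‖ < 1 := by
      rw [div_sub_one (hne z), norm_div, div_lt_one (norm_pos_iff.2 (hne z))]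
      exact hn z
    left
    have := (Complex.abs_re_le_norm (u' z / u z - 1)).trans_lt h1
    rw [abs_lt] at this
    simp at this
    linarith
  have := h.mul (HasDeg.exp (h := fun z => Complex.log (u' z / u z)) (by
    exact (hu'.div hu hne).clog hs))
  rw [add_zero] at this
  convert this using 2 with z
  rw [Complex.exp_log (Complex.slitPlane_ne_zero (hs z))]
  field_simp [hne z]

lemma HasDeg.const {a : ℂ} (ha : a ≠ 0) : HasDeg (fun _ => a) 0 :=
  ⟨fun _ => Complex.log a, continuous_const, by simp [Complex.exp_log ha]⟩

lemma deg_inside {α β : ℂ} {r : ℝ} (h : ‖β - α‖ < r) :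
    HasDeg (fun z : Circle => α + r * z - β) 1 := by
  have hr : 0 < r := (norm_nonneg _).trans_lt h
  have h1 : HasDeg (fun z : Circle => (r : ℂ) * z) 1 :=
    ⟨fun _ => Complex.log r, continuous_const, fun z => by
      rw [Complex.exp_log (by exact_mod_cast hr.ne')]; simp; ring⟩
  refine h1.near (by fun_prop) (by fun_prop) fun z => ?_
  have : α + r * z - β - r * z = -(β - α) := by ring
  rw [this, norm_neg]
  rw [norm_mul, Circle.norm_coe]
  simpa [abs_of_pos hr] using h

lemma deg_outside {α β : ℂ} {r : ℝ} (hr : 0 < r) (h : r < ‖β - α‖) :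
    HasDeg (fun z : Circle => α + r * z - β) 0 := by
  have h1 : HasDeg (fun z : Circle => α - β) 0 := HasDeg.const (by
    intro h0
    rw [← neg_sub, h0] at h
    simp at h
    linarith)
  refine h1.near (by fun_prop) (by fun_prop) fun z => ?_
  have : α + r * z - β - (α - β) = r * z := by ring
  rw [this, norm_sub_rev α β]
  rw [norm_mul, Circle.norm_coe]
  simpa [abs_of_pos hr] using h

lemma punct_log (α : ℂ) (r : ℝ) (hr : 0 < r) (U : ℂ → ℂ)
    (hU : ContinuousOn U (Metric.closedBall α r \ {α}))
    (h0 : ∀ t ∈ Metric.closedBall α r \ {α}, U t ≠ 0)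
    (hd : HasDeg (fun z : Circle => U (α + r * z)) 0) :
    ∃ H : ℂ → ℂ, ContinuousOn H {α}ᶜ ∧
      ∀ t ∈ Metric.closedBall α r \ {α}, U t = Complex.exp (H t) := by
  obtain ⟨l, hl, hl1⟩ := hd
  have hmem : ∀ (z : Circle) (s : ℝ) (τ : I),
      α + (r * Real.exp (τ * min s 0) : ℝ) * (z : ℂ) ∈ Metric.closedBall α r \ {α} := by
    intro z s τ
    constructor
    · rw [mem_closedBall_iff_norm, add_sub_cancel_left, norm_mul, Circle.norm_coe, mul_one,
        Complex.norm_real, Real.norm_of_nonneg (by positivity)]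
      have : Real.exp (τ * min s 0) ≤ 1 := by
        rw [Real.exp_le_one_iff]
        exact mul_nonpos_of_nonneg_of_nonpos τ.2.1 (min_le_right _ _)
      nlinarith
    · have : (r * Real.exp (τ * min s 0) : ℝ) * (z : ℂ) ≠ 0 :=
        mul_ne_zero (by exact_mod_cast (by positivity : (r * Real.exp (τ * min s 0) : ℝ) ≠ 0))
          (Circle.coe_ne_zero z)
      simpa using this
  obtain ⟨k, hk, hk1, hk0⟩ := hlog
    (fun (a : Circle × ℝ) (τ : I) => U (α + (r * Real.exp (τ * min a.2 0) : ℝ) * (a.1 : ℂ)))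
    (hU.comp_continuous (by fun_prop) (fun p => hmem p.2.1 p.2.2 p.1))
    (fun a s => h0 _ (hmem _ _ _)) (fun a => l a.1) (by fun_prop)
    (fun a => by
      have := hl1 a.1
      simp only [zpow_zero, one_mul] at this
      simp [← this])
  have hn : ∀ t : {t : ℂ // t ∈ ({α}ᶜ : Set ℂ)}, ‖(t : ℂ) - α‖ ≠ 0 := fun t =>
    norm_ne_zero_iff.2 (sub_ne_zero.2 t.2)
  let ζ : {t : ℂ // t ∈ ({α}ᶜ : Set ℂ)} → Circle := fun t =>
    ⟨((t : ℂ) - α) / (‖(t : ℂ) - α‖ : ℝ), by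
      refine mem_sphere_zero_iff_norm.2 ?_
      simp [hn t]⟩
  have hζ : Continuous ζ := by
    refine Continuous.subtype_mk ?_ _
    refine Continuous.div (by fun_prop) (by fun_prop) fun t => by exact_mod_cast hn t
  let s : {t : ℂ // t ∈ ({α}ᶜ : Set ℂ)} → ℝ := fun t => Real.log (‖(t : ℂ) - α‖ / r)
  have hs : Continuous s := by
    refine Continuous.log (by fun_prop) fun t => div_ne_zero (hn t) hr.ne'
  classical
  refine ⟨fun t => if h : t ∈ ({α}ᶜ : Set ℂ) then k (ζ ⟨t, h⟩, s ⟨t, h⟩) 1 else 0, ?_, ?_⟩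
  · rw [continuousOn_iff_continuous_domRestrict]
    have : Continuous fun t : {t : ℂ // t ∈ ({α}ᶜ : Set ℂ)} => k (ζ t, s t) 1 :=
      hk.comp (f := fun t => ((1 : I), (ζ t, s t))) (by fun_prop)
    convert this using 2 with t
    simp only [Set.domRestrict_apply]
    rw [dif_pos t.2]
  · rintro t ⟨ht1, ht2⟩
    have ht3 : t ∈ ({α}ᶜ : Set ℂ) := ht2
    simp only
    rw [dif_pos ht3, hk1]
    congr 1
    have h1 : s ⟨t, ht3⟩ ≤ 0 := by
      apply Real.log_nonpos (by positivity)
      rw [div_le_one hr]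
      exact mem_closedBall_iff_norm.1 ht1
    have h2 : Real.exp (s ⟨t, ht3⟩) = ‖t - α‖ / r := by
      apply Real.exp_log
      have := hn ⟨t, ht3⟩
      positivity
    simp only [min_eq_left h1, Set.Icc.coe_one, one_mul, h2]
    rw [mul_div_cancel₀ _ hr.ne']
    have : ((‖t - α‖ : ℝ) : ℂ) ≠ 0 := by exact_mod_cast hn ⟨t, ht3⟩
    change t = α + (‖t - α‖ : ℝ) * ((t - α) / (‖t - α‖ : ℝ))
    field_simp
    ring

lemma fibre_step (α : ℂ) (F : Finset ℂ) (hα : α ∉ F) (U : ℂ → ℂ)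
    (hU : ContinuousOn U ((insert α F : Finset ℂ) : Set ℂ)ᶜ)
    (h0 : ∀ t ∉ (insert α F : Finset ℂ), U t ≠ 0) :
    ∃ (c : ℤ) (U' k : ℂ → ℂ), ContinuousOn U' (F : Set ℂ)ᶜ ∧ (∀ t ∉ F, U' t ≠ 0) ∧
      ContinuousOn k ((insert α F : Finset ℂ) : Set ℂ)ᶜ ∧
      ∀ t ∉ (insert α F : Finset ℂ), U t = (t - α) ^ c * U' t * Complex.exp (k t) := by
  obtain ⟨r, hr, hrF⟩ : ∃ r > 0, Metric.closedBall α r ⊆ (F : Set ℂ)ᶜ :=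
    Metric.nhds_basis_closedBall.mem_iff.1
      (F.finite_toSet.isClosed.isOpen_compl.mem_nhds (by simpa using hα))
  have hsub : Metric.closedBall α r \ {α} ⊆ ((insert α F : Finset ℂ) : Set ℂ)ᶜ := by
    rintro t ⟨h1, h2⟩
    have := hrF h1
    simp at this h2 ⊢
    tauto
  have hsub' : ∀ t ∈ Metric.closedBall α r \ {α}, t ∉ (insert α F : Finset ℂ) := fun t ht => by
    simpa using hsub ht
  have hcm : ∀ z : Circle, α + r * z ∈ Metric.closedBall α r \ {α} := by
    intro z
    constructor
    · rw [mem_closedBall_iff_norm, add_sub_cancel_left, norm_mul, Circle.norm_coe, mul_one,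
        Complex.norm_real, Real.norm_of_nonneg hr.le]
    · have : (r : ℂ) * (z : ℂ) ≠ 0 :=
        mul_ne_zero (by exact_mod_cast hr.ne') (Circle.coe_ne_zero z)
      simpa using this
  obtain ⟨c, hc⟩ := exists_deg (fun z : Circle => U (α + r * z))
    (hU.comp_continuous (by fun_prop) fun z => hsub (hcm z)) (fun z => h0 _ (hsub' _ (hcm z)))
  set U1 : ℂ → ℂ := fun t => U t * (t - α) ^ (-c) with hU1
  have hta : ∀ t ∉ (insert α F : Finset ℂ), t - α ≠ 0 := by
    intro t ht h
    rw [sub_eq_zero] at h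
    simp [h] at ht
  have hU1c : ContinuousOn U1 ((insert α F : Finset ℂ) : Set ℂ)ᶜ := by
    refine hU.mul (ContinuousOn.zpow₀ (by fun_prop) _ fun t ht => Or.inl (hta t (by simpa using ht)))
  have hU10 : ∀ t ∉ (insert α F : Finset ℂ), U1 t ≠ 0 := fun t ht =>
    mul_ne_zero (h0 t ht) (zpow_ne_zero _ (hta t ht))
  have hdeg : HasDeg (fun z : Circle => U1 (α + r * z)) 0 := by
    have h1 := hc.mul ((deg_inside (α := α) (β := α) (r := r) (by simpa using hr)).zpow (-c))
    rw [show c + -c * 1 = 0 by ring] at h1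
    exact h1
  obtain ⟨H, hH, hH1⟩ := punct_log α r hr U1 (hU1c.mono hsub)
    (fun t ht => hU10 t (hsub' t ht)) hdeg
  let θ : ℂ → ℝ := fun t => max 0 (min 1 (2 - 2 * ‖t - α‖ / r))
  have hθ : Continuous θ := by fun_prop
  have hθ1 : ∀ t, ‖t - α‖ < r / 2 → θ t = 1 := by
    intro t ht
    have : 1 ≤ 2 - 2 * ‖t - α‖ / r := by
      have : 2 * ‖t - α‖ / r ≤ 1 := by rw [div_le_one hr]; linarith
      linarith
    simp [θ, min_eq_left this]
  let k : ℂ → ℂ := fun t => θ t * H t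
  have hk : ContinuousOn k {α}ᶜ := by
    refine ContinuousOn.mul ?_ hH
    exact (by fun_prop : Continuous fun t => (θ t : ℂ)).continuousOn
  have hsc : ((insert α F : Finset ℂ) : Set ℂ)ᶜ ⊆ {α}ᶜ := by
    intro t ht
    simp at ht ⊢
    tauto
  classical
  let U' : ℂ → ℂ := fun t => if t = α then 1 else U1 t * Complex.exp (- k t)
  have hU'1 : ∀ t, ‖t - α‖ < r / 2 → U' t = 1 := by
    intro t ht
    by_cases h : t = α
    · simp [U', h]
    · have := hH1 t ⟨mem_closedBall_iff_norm.2 (by linarith), h⟩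
      simp only [U', if_neg h, this, k, hθ1 t ht]
      rw [← Complex.exp_add]
      simp
  refine ⟨c, U', k, ?_, ?_, hk.mono hsc, ?_⟩
  · intro t ht
    by_cases h : t = α
    · subst h
      apply ContinuousAt.continuousWithinAt
      have : U' =ᶠ[𝓝 t] fun _ => 1 := by
        filter_upwards [Metric.ball_mem_nhds t (half_pos hr)] with x hx
        exact hU'1 x (mem_ball_iff_norm.1 hx)
      exact continuousAt_const.congr this.symm
    · apply ContinuousAt.continuousWithinAt
      have hmem : t ∈ ((insert α F : Finset ℂ) : Set ℂ)ᶜ := by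
        simp at ht ⊢
        tauto
      have hopen : IsOpen ((insert α F : Finset ℂ) : Set ℂ)ᶜ :=
        (Finset.finite_toSet _).isClosed.isOpen_compl
      have hc1 : ContinuousOn (fun t => U1 t * Complex.exp (- k t))
          ((insert α F : Finset ℂ) : Set ℂ)ᶜ := hU1c.mul ((hk.mono hsc).neg.cexp)
      refine (hc1.continuousAt (hopen.mem_nhds hmem)).congr ?_
      filter_upwards [hopen.mem_nhds hmem] with x hx
      have : x ≠ α := hsc hx
      simp only [U']
      rw [if_neg this]
  · intro t ht
    by_cases h : t = α
    · simp [U', h]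
    · simp only [U', if_neg h]
      exact mul_ne_zero (hU10 t (by simp; tauto)) (Complex.exp_ne_zero _)
  · intro t ht
    have h := hta t ht
    simp only [U', if_neg (sub_ne_zero.1 h), hU1]
    rw [zpow_neg, Complex.exp_neg]
    field_simp

lemma fibre_log (F : Finset ℂ) : ∀ (U : ℂ → ℂ) (_ : ContinuousOn U (F : Set ℂ)ᶜ)
    (_ : ∀ t ∉ F, U t ≠ 0), ∃ (c : ℂ → ℤ) (h : ℂ → ℂ), ContinuousOn h (F : Set ℂ)ᶜ ∧
      ∀ t ∉ F, U t = Complex.exp (h t) * ∏ α ∈ F, (t - α) ^ c α := by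
  classical
  induction F using Finset.induction_on with
  | empty =>
    intro U hU h0
    obtain ⟨h, hh, hh1⟩ := log_normed U (by simpa [continuousOn_univ] using hU)
      (fun a => h0 a (by simp))
    exact ⟨0, h, hh.continuousOn, fun t _ => by simp [hh1]⟩
  | insert α F hα ih =>
    intro U hU h0
    obtain ⟨c0, U', k, hU', hU'0, hk, he⟩ := fibre_step α F hα U hU h0
    obtain ⟨c, h, hh, hh1⟩ := ih U' hU' hU'0
    refine ⟨Function.update c α c0, fun t => h t + k t, ?_, ?_⟩
    · refine (hh.mono ?_).add hk
      intro t ht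
      simp at ht ⊢
      tauto
    · intro t ht
      rw [he t ht, hh1 t (by simp at ht; tauto), Finset.prod_insert hα, Complex.exp_add,
        Function.update_self]
      have : ∏ x ∈ F, (t - x) ^ Function.update c α c0 x = ∏ x ∈ F, (t - x) ^ c x := by
        refine Finset.prod_congr rfl fun x hx => ?_
        rw [Function.update_of_ne]
        rintro rfl
        exact hα hx
      rw [this]
      ring

/-- degree along a circle from the fibre decomposition -/
lemma fibre_deg (F : Finset ℂ) (U h : ℂ → ℂ) (c : ℂ → ℤ) (hh : ContinuousOn h (F : Set ℂ)ᶜ)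
    (he : ∀ t ∉ F, U t = Complex.exp (h t) * ∏ α ∈ F, (t - α) ^ c α)
    (α₀ : ℂ) (r : ℝ) (hr : 0 < r) (hc : ∀ β ∈ F, ‖β - α₀‖ ≠ r) :
    HasDeg (fun z : Circle => U (α₀ + r * z)) (∑ β ∈ F with ‖β - α₀‖ < r, c β) := by
  have hz : ∀ z : Circle, α₀ + r * z ∉ F := by
    intro z hz
    apply hc _ hz
    rw [add_sub_cancel_left, norm_mul, Circle.norm_coe, mul_one,
        Complex.norm_real, Real.norm_of_nonneg hr.le]
  have h1 : HasDeg (fun z : Circle => Complex.exp (h (α₀ + r * z))) 0 :=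
    HasDeg.exp (hh.comp_continuous (by fun_prop) fun z => by simpa using hz z)
  have h2 := HasDeg.prod F (fun β (z : Circle) => (α₀ + r * z - β) ^ c β)
    (fun β => c β * if ‖β - α₀‖ < r then 1 else 0) (by
      intro β hβ
      split_ifs with hlt
      · exact (deg_inside hlt).zpow _
      · exact (deg_outside hr (lt_of_le_of_ne (not_lt.1 hlt) (hc β hβ).symm)).zpow _)
  have h3 := h1.mul h2
  rw [zero_add] at h3
  rw [Finset.sum_filter]
  convert h3 using 2 with z β hβ
  · rw [he _ (hz z)]
  · simp

lemma entire_poly (a : ℂ → ℂ) (ha : Differentiable ℂ a) (C : ℝ) (K : ℕ)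
    (hb : ∀ᶠ s in cocompact ℂ, ‖a s‖ ≤ C * (1 + ‖s‖) ^ K) :
    ∃ q : Polynomial ℂ, q.natDegree ≤ K ∧ ∀ s, a s = q.eval s := by
  have hz : ∀ m, K < m → iteratedDeriv m a 0 = 0 := by
    intro m hm
    have hb' : ∀ᶠ R : ℝ in atTop, ∀ s : ℂ, ‖s‖ = R → ‖a s‖ ≤ C * (1 + ‖s‖) ^ K := by
      rw [← Metric.cobounded_eq_cocompact, ← comap_norm_atTop, eventually_comap] at hb
      exact hb
    have h1 : ∀ᶠ R : ℝ in atTop, ‖iteratedDeriv m a 0‖ ≤ m.factorial * (C * (1 + R) ^ K) / R ^ m := by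
      filter_upwards [hb', eventually_gt_atTop 0] with R hR hR0
      refine Complex.norm_iteratedDeriv_le_of_forall_mem_sphere_norm_le m hR0 ha.diffContOnCl ?_
      intro z hz
      rw [mem_sphere_zero_iff_norm] at hz
      have := hR z hz
      rwa [hz] at this
    have h2 : Tendsto (fun R : ℝ => m.factorial * (C * (1 + R) ^ K) / R ^ m) atTop (𝓝 0) := by
      have := Polynomial.div_tendsto_atTop_zero_of_degree_lt
        (Polynomial.C (m.factorial * C : ℝ) * (1 + Polynomial.X) ^ K) (Polynomial.X ^ m) (by
          rw [Polynomial.degree_X_pow]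
          refine lt_of_le_of_lt (Polynomial.degree_le_natDegree) ?_
          have : (Polynomial.C (m.factorial * C : ℝ) * (1 + Polynomial.X) ^ K).natDegree ≤ K := by
            refine (Polynomial.natDegree_C_mul_le _ _).trans ?_
            refine Polynomial.natDegree_pow_le.trans ?_
            rw [add_comm, ← Polynomial.C_1, Polynomial.natDegree_X_add_C, mul_one]
          exact_mod_cast this.trans_lt hm)
      refine this.congr fun R => ?_
      simp [mul_assoc]
    have := ge_of_tendsto h2 h1
    exact norm_le_zero_iff.1 this
  refine ⟨∑ i ∈ Finset.range (K + 1), Polynomial.C ((i.factorial : ℂ)⁻¹ * iteratedDeriv i a 0) * Polynomial.X ^ i, ?_, ?_⟩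
  · refine Polynomial.natDegree_sum_le_of_forall_le _ _ fun i hi => ?_
    refine (Polynomial.natDegree_C_mul_X_pow_le _ _).trans ?_
    simp at hi; omega
  · intro s
    have h := Complex.taylorSeries_eq_of_entire' 0 s ha
    rw [← h, tsum_eq_sum (s := Finset.range (K + 1))]
    · simp [Polynomial.eval_finsetSum]
    · intro i hi
      rw [hz i (by simpa using hi)]
      simp

lemma liou (a : ℂ → ℂ) (T : Finset ℂ) (hd : ∀ s ∉ T, DifferentiableAt ℂ a s) (C : ℝ) (K : ℕ)
    (hb : ∀ s ∉ T, ‖a s‖ ≤ C * (1 + ‖s‖) ^ K) :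
    ∃ q : Polynomial ℂ, q.natDegree ≤ K ∧ ∀ s ∉ T, a s = q.eval s := by
  classical
  let b : ℂ → ℂ := fun s => if s ∈ T then limUnder (𝓝[≠] s) a else a s
  have hbT : ∀ s ∉ T, b s = a s := fun s hs => if_neg hs
  have hopen : IsOpen (T : Set ℂ)ᶜ := T.finite_toSet.isClosed.isOpen_compl
  have hbd : Differentiable ℂ b := by
    intro τ
    by_cases hτ : τ ∈ T
    · have hN : ((T.erase τ : Finset ℂ) : Set ℂ)ᶜ ∩ Metric.ball τ 1 ∈ 𝓝 τ :=
        inter_mem ((Finset.finite_toSet _).isClosed.isOpen_compl.mem_nhds (by simp))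
          (Metric.ball_mem_nhds _ one_pos)
      have hnT : ∀ s ∈ (((T.erase τ : Finset ℂ) : Set ℂ)ᶜ ∩ Metric.ball τ 1) \ {τ}, s ∉ T := by
        rintro s ⟨⟨h1, h2⟩, h3⟩
        simp at h1 h3
        tauto
      have := Complex.differentiableOn_update_limUnder_of_bddAbove (f := a) hN
        (fun s hs => (hd s (hnT s hs)).differentiableWithinAt) (by
          refine ⟨|C| * (1 + (‖τ‖ + 1)) ^ K, ?_⟩
          rintro _ ⟨s, hs, rfl⟩
          have h1 := hb s (hnT s hs)
          have h2 : ‖s‖ ≤ ‖τ‖ + 1 := by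
            have := mem_ball_iff_norm.1 hs.1.2
            have := norm_le_norm_add_norm_sub' s τ
            linarith
          refine h1.trans ?_
          refine (mul_le_mul_of_nonneg_right (le_abs_self C) (by positivity)).trans ?_
          gcongr)
      refine (this.differentiableAt hN).congr_of_eventuallyEq ?_
      filter_upwards [hN] with s hs
      by_cases h : s = τ
      · subst h
        simp [b, hτ]
      · rw [Function.update_of_ne h, hbT s (hnT s ⟨hs, h⟩)]
    · refine (hd τ hτ).congr_of_eventuallyEq ?_
      filter_upwards [hopen.mem_nhds (by simpa using hτ)] with s hs
      exact hbT s (by simpa using hs)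
  obtain ⟨q, hq, hq1⟩ := entire_poly b hbd C K (by
    have : ∀ᶠ s in cocompact ℂ, s ∈ (T : Set ℂ)ᶜ := T.finite_toSet.isCompact.compl_mem_cocompact
    filter_upwards [this] with s hs
    rw [hbT s (by simpa using hs)]
    exact hb s (by simpa using hs))
  exact ⟨q, hq, fun s hs => by rw [← hbT s hs, hq1]⟩

lemma infinite_ne (p : Polynomial ℂ) (hp : p ≠ 0) : {s : ℂ | p.eval s ≠ 0}.Infinite := by
  have : {s : ℂ | p.eval s ≠ 0} = (p.roots.toFinset : Set ℂ)ᶜ := by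
    ext s
    simp [hp]
  rw [this]
  exact (Finset.finite_toSet _).infinite_compl

lemma mvpoly (K : ℕ) (n : ℕ) : ∀ (a : (Fin n → ℂ) → ℂ) (D : MvPolynomial (Fin n) ℂ) (_ : D ≠ 0)
    (_ : ∀ x i, ∃ q : Polynomial ℂ, q.natDegree ≤ K ∧
      ∀ s, MvPolynomial.eval (Function.update x i s) D ≠ 0 → a (Function.update x i s) = q.eval s),
    ∃ Q D' : MvPolynomial (Fin n) ℂ, D' ≠ 0 ∧
      ∀ x, MvPolynomial.eval x D' ≠ 0 → a x = MvPolynomial.eval x Q := by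
  induction n with
  | zero =>
    intro a D hD h
    refine ⟨MvPolynomial.C (a 0), 1, one_ne_zero, fun x _ => ?_⟩
    rw [MvPolynomial.eval_C, Subsingleton.elim x 0]
  | succ n ih =>
    intro a D hD h
    obtain ⟨x0, hx0⟩ : ∃ x, MvPolynomial.eval x D ≠ 0 := by
      by_contra! hh
      exact hD (MvPolynomial.funext fun x => by simpa using hh x)
    have hev : ∀ (c : ℂ) (y : Fin n → ℂ), MvPolynomial.eval (Fin.cons c y : Fin (n+1) → ℂ) D =
        (Polynomial.map (MvPolynomial.eval y) (MvPolynomial.finSuccEquiv ℂ n D)).eval c :=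
      fun c y => MvPolynomial.eval_eq_eval_mv_eval' y c D
    have hinf := infinite_ne (Polynomial.map (MvPolynomial.eval (Fin.tail x0)) (MvPolynomial.finSuccEquiv ℂ n D)) (by
      intro h0
      apply hx0
      rw [← Fin.cons_self_tail x0, hev, h0]
      simp)
    obtain ⟨s, hs, hcard⟩ := hinf.exists_subset_card_eq (K + 1)
    let Dc : ℂ → MvPolynomial (Fin n) ℂ := fun c =>
      (MvPolynomial.finSuccEquiv ℂ n D).eval (MvPolynomial.C c)
    have hDc : ∀ c y, MvPolynomial.eval y (Dc c) = MvPolynomial.eval (Fin.cons c y : Fin (n+1) → ℂ) D := by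
      intro c y
      simp only [Dc]
      rw [hev, Polynomial.eval_map, Polynomial.eval, Polynomial.hom_eval₂]
      simp
    have hDc0 : ∀ c ∈ s, Dc c ≠ 0 := by
      intro c hc h0
      apply hs hc
      rw [← hev, ← hDc, h0, map_zero]
    have key : ∀ c, ∃ Q D' : MvPolynomial (Fin n) ℂ, D' ≠ 0 ∧ (c ∈ s →
      ∀ y, MvPolynomial.eval y D' ≠ 0 → a (Fin.cons c y) = MvPolynomial.eval y Q) := by
      intro c
      by_cases hc : c ∈ s
      · obtain ⟨Q, D', h1, h2⟩ := ih (fun y => a (Fin.cons c y)) (Dc c) (hDc0 c hc) (by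
          intro y i
          obtain ⟨q, hq, hq1⟩ := h (Fin.cons c y) i.succ
          refine ⟨q, hq, fun t ht => ?_⟩
          rw [hDc] at ht
          have := hq1 t
          rw [← Fin.cons_update] at this
          exact this ht)
        exact ⟨Q, D', h1, fun _ => h2⟩
      · exact ⟨0, 1, one_ne_zero, fun h => absurd h hc⟩
    choose Q D' hD' hQ using key
    refine ⟨∑ c ∈ s, MvPolynomial.rename Fin.succ (Q c) *
        Polynomial.aeval (MvPolynomial.X 0) (Lagrange.basis s id c),
      D * ∏ c ∈ s, MvPolynomial.rename Fin.succ (D' c * Dc c), ?_, ?_⟩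
    · refine mul_ne_zero hD (Finset.prod_ne_zero_iff.2 fun c hc => ?_)
      rw [Ne, MvPolynomial.rename_eq_zero_iff_of_injective _ (Fin.succ_injective n)]
      exact mul_ne_zero (hD' c) (hDc0 c hc)
    · intro x hx
      rw [map_mul, map_prod, mul_ne_zero_iff, Finset.prod_ne_zero_iff] at hx
      obtain ⟨hx1, hx2⟩ := hx
      obtain ⟨q, hq, hq1⟩ := h x 0
      have hupd : ∀ t, Function.update x 0 t = Fin.cons t (Fin.tail x) := by
        intro t
        conv_lhs => rw [← Fin.cons_self_tail x, Fin.update_cons_zero]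
      have hqc : ∀ c ∈ s, q.eval c = MvPolynomial.eval (Fin.tail x) (Q c) := by
        intro c hc
        have h3 := hx2 c hc
        rw [MvPolynomial.eval_rename, map_mul, mul_ne_zero_iff] at h3
        have h4 : x ∘ Fin.succ = Fin.tail x := rfl
        rw [h4] at h3
        rw [← hQ c hc _ h3.1, ← hupd, hq1]
        rw [hupd, ← hDc]
        exact h3.2
      have hqx : a x = q.eval (x 0) := by
        have := hq1 (x 0)
        rw [Function.update_eq_self] at this
        exact this hx1
      have hL : q = Lagrange.interpolate s id (fun c => q.eval c) :=
        Lagrange.eq_interpolate (s := s) (v := id) (Set.injOn_id _) (by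
          rw [hcard]
          refine (Polynomial.degree_le_natDegree).trans_lt ?_
          exact_mod_cast Nat.lt_succ_of_le hq)
      rw [hqx, hL, Lagrange.interpolate_apply, Polynomial.eval_finsetSum, map_sum]
      refine Finset.sum_congr rfl fun c hc => ?_
      rw [Polynomial.eval_mul, Polynomial.eval_C, map_mul, MvPolynomial.eval_rename, hqc c hc]
      congr 1
      rw [Polynomial.aeval_def, Polynomial.hom_eval₂]
      have hid : (MvPolynomial.eval x).comp MvPolynomial.C = RingHom.id ℂ := by
        apply RingHom.ext
        intro z
        simp
      simp [Polynomial.eval₂_eq_eval_map, hid]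

noncomputable def sh {n : ℕ} (v : Fin n → ℂ) :
    MvPolynomial (Fin n) ℂ →ₐ[ℂ] Polynomial (MvPolynomial (Fin n) ℂ) :=
  MvPolynomial.aeval (fun i => Polynomial.C (MvPolynomial.X i) +
    Polynomial.C (MvPolynomial.C (v i)) * Polynomial.X)

/-- evaluation at `(x,t)` -/
noncomputable def ev2 {n : ℕ} (x : Fin n → ℂ) (t : ℂ) :
    Polynomial (MvPolynomial (Fin n) ℂ) →+* ℂ :=
  Polynomial.eval₂RingHom (MvPolynomial.eval x) t

lemma ev2_eq {n : ℕ} (x : Fin n → ℂ) (t : ℂ) (P : Polynomial (MvPolynomial (Fin n) ℂ)) :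
    ev2 x t P = (P.map (MvPolynomial.eval x)).eval t := by
  simp [ev2, Polynomial.eval_map]

lemma ev2_sh {n : ℕ} (v x : Fin n → ℂ) (t : ℂ) (g : MvPolynomial (Fin n) ℂ) :
    ev2 x t (sh v g) = MvPolynomial.eval (x + t • v) g := by
  have : (ev2 x t).comp (sh v).toRingHom = MvPolynomial.eval (x + t • v) := by
    apply MvPolynomial.ringHom_ext
    · intro r
      simp [ev2, sh, Polynomial.algebraMap_eq, MvPolynomial.algebraMap_eq]
    · intro i
      simp [ev2, sh]
      ring
  exact congrArg (fun F : _ →+* ℂ => F g) this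

noncomputable def sg {n : ℕ} (v : Fin n → ℂ) :
    Polynomial (MvPolynomial (Fin n) ℂ) →+* Polynomial (MvPolynomial (Fin n) ℂ) :=
  Polynomial.eval₂RingHom (sh v).toRingHom Polynomial.X

lemma sg_sg {n : ℕ} (v w : Fin n → ℂ) (h : v + w = 0) : (sg v).comp (sg w) = RingHom.id _ := by
  apply Polynomial.ringHom_ext'
  · apply MvPolynomial.ringHom_ext
    · intro r
      simp [sg, sh, MvPolynomial.algebraMap_eq]
    · intro i
      have : v i = - w i := by
        have := congrFun h i
        simp at this
        linear_combination this
      simp [sg, sh, MvPolynomial.algebraMap_eq, this]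
      ring
  · simp [sg]

noncomputable def sgE {n : ℕ} (v : Fin n → ℂ) :
    Polynomial (MvPolynomial (Fin n) ℂ) ≃+* Polynomial (MvPolynomial (Fin n) ℂ) :=
  RingEquiv.ofRingHom (sg v) (sg (-v)) (sg_sg _ _ (by simp)) (sg_sg _ _ (by simp))

lemma sgE_C {n : ℕ} (v : Fin n → ℂ) (g : MvPolynomial (Fin n) ℂ) :
    sgE v (Polynomial.C g) = sh v g := by
  simp [sgE, sg]

lemma sh_prime {n : ℕ} (v : Fin n → ℂ) (g : MvPolynomial (Fin n) ℂ) (hg : Irreducible g) :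
    Prime (sh v g) := by
  rw [← sgE_C, MulEquiv.prime_iff, Polynomial.prime_C_iff]
  exact hg.prime

lemma sh_squarefree {n : ℕ} (v : Fin n → ℂ) (g : MvPolynomial (Fin n) ℂ) (hg : Squarefree g) 
    (hg0 : g ≠ 0) :
    Squarefree (sh v g) := by
  intro q hq
  rw [← sgE_C] at hq
  have h1 : (sgE v).symm q * (sgE v).symm q ∣ Polynomial.C g := by
    rw [← map_mul]
    have := map_dvd (sgE v).symm hq
    simpa using this
  have h2 : ((sgE v).symm q).natDegree = 0 := by
    have := Polynomial.natDegree_le_of_dvd ((dvd_mul_right _ _).trans h1)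
      (by simpa using hg0)
    simpa using this
  rw [Polynomial.natDegree_eq_zero] at h2
  obtain ⟨c, hc⟩ := h2
  rw [← hc, ← Polynomial.C_mul, Polynomial.C_dvd_iff_dvd_coeff] at h1
  have h3 := hg c (by simpa using h1 0)
  have h4 : IsUnit ((sgE v).symm q) := by rw [← hc]; exact h3.map Polynomial.C
  simpa using h4

lemma coeff_prod_sum {R ι : Type*} [CommRing R] (s : Finset ι) (f : ι → Polynomial R) (m : ι → ℕ)
    (h : ∀ i ∈ s, (f i).natDegree ≤ m i) :
    (∏ i ∈ s, f i).coeff (∑ i ∈ s, m i) = ∏ i ∈ s, (f i).coeff (m i) := by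
  classical
  induction s using Finset.induction_on with
  | empty => simp
  | insert a s ha ih =>
    rw [Finset.prod_insert ha, Finset.sum_insert ha, Finset.prod_insert ha,
      Polynomial.coeff_mul_add_eq_of_natDegree_le (h a (Finset.mem_insert_self _ _)),
      ih (fun i hi => h i (Finset.mem_insert_of_mem hi))]
    exact (Polynomial.natDegree_prod_le _ _).trans
      (Finset.sum_le_sum fun i hi => h i (Finset.mem_insert_of_mem hi))

lemma sh_monomial {n : ℕ} (v : Fin n → ℂ) (m : Fin n →₀ ℕ) (a : ℂ) :
    (sh v (MvPolynomial.monomial m a)).natDegree ≤ m.degree ∧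
    (sh v (MvPolynomial.monomial m a)).coeff m.degree =
      MvPolynomial.C (MvPolynomial.eval v (MvPolynomial.monomial m a)) := by
  have h1 : sh v (MvPolynomial.monomial m a) = Polynomial.C (MvPolynomial.C a) *
    ∏ i, (Polynomial.C (MvPolynomial.X i) +
    Polynomial.C (MvPolynomial.C (v i)) * Polynomial.X) ^ (m i) := by
    rw [sh, MvPolynomial.aeval_monomial, Finsupp.prod_fintype _ _ (by simp)]
    rfl
  have hl : ∀ i, (Polynomial.C (MvPolynomial.X i) +
    Polynomial.C (MvPolynomial.C (v i)) * Polynomial.X : Polynomial (MvPolynomial (Fin n) ℂ)).natDegree ≤ 1 := by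
    intro i
    rw [add_comm]
    exact Polynomial.natDegree_linear_le
  have hl2 : ∀ i, ((Polynomial.C (MvPolynomial.X i) +
    Polynomial.C (MvPolynomial.C (v i)) * Polynomial.X : Polynomial (MvPolynomial (Fin n) ℂ)) ^ m i).natDegree ≤ m i := by
    intro i
    simpa using Polynomial.natDegree_pow_le_of_le (m i) (hl i)
  have hdeg : m.degree = ∑ i, m i := by
    rw [Finsupp.degree_eq_sum]
  constructor
  · rw [h1, hdeg]
    refine (Polynomial.natDegree_C_mul_le _ _).trans ?_
    exact (Polynomial.natDegree_prod_le _ _).trans (Finset.sum_le_sum fun i _ => hl2 i)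
  · rw [h1, hdeg, Polynomial.coeff_C_mul, coeff_prod_sum _ _ _ (fun i _ => hl2 i)]
    have : ∀ i, ((Polynomial.C (MvPolynomial.X i) +
      Polynomial.C (MvPolynomial.C (v i)) * Polynomial.X : Polynomial (MvPolynomial (Fin n) ℂ)) ^ m i).coeff (m i) = MvPolynomial.C (v i) ^ m i := by
      intro i
      have := Polynomial.coeff_pow_of_natDegree_le (hl i) (m := m i)
      rw [mul_one] at this
      rw [this]
      simp
    simp only [this]
    rw [MvPolynomial.eval_monomial, Finsupp.prod_fintype _ _ (by simp)]
    simp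

lemma sh_monic {n : ℕ} (v : Fin n → ℂ) (g : MvPolynomial (Fin n) ℂ) (d : ℕ)
    (hg : g.IsHomogeneous d) (hv : MvPolynomial.eval v g = 1) :
    (sh v g).Monic ∧ (sh v g).natDegree = d := by
  have hdeg : ∀ m ∈ g.support, m.degree = d := by
    intro m hm
    rw [Finsupp.degree_eq_weight_one]
    exact hg (MvPolynomial.mem_support_iff.1 hm)
  have h1 : (sh v g).natDegree ≤ d := by
    rw [g.as_sum, map_sum]
    refine Polynomial.natDegree_sum_le_of_forall_le _ _ fun m hm => ?_
    rw [← hdeg m hm]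
    exact (sh_monomial v m _).1
  have h2 : (sh v g).coeff d = 1 := by
    have : (sh v g).coeff d = MvPolynomial.C (MvPolynomial.eval v g) := by
      conv_lhs => rw [g.as_sum, map_sum, Polynomial.finsetSum_coeff]
      conv_rhs => rw [g.as_sum, map_sum, map_sum]
      refine Finset.sum_congr rfl fun m hm => ?_
      rw [← hdeg m hm]
      exact (sh_monomial v m _).2
    rw [this, hv, map_one]
  have hm := Polynomial.monic_of_natDegree_le_of_coeff_eq_one d h1 h2
  refine ⟨hm, ?_⟩
  exact le_antisymm h1 (Polynomial.le_natDegree_of_ne_zero (by rw [h2]; exact one_ne_zero))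

lemma disc_exists {R : Type*} [CommRing R] [IsDomain R] [IsIntegrallyClosed R] [CharZero R]
    (P : Polynomial R) (hP : P.Monic) (hsf : Squarefree P) :
    ∃ (A B : Polynomial R) (D : R), D ≠ 0 ∧ A * P + B * P.derivative = Polynomial.C D := by
  let K := FractionRing R
  have hinj := FaithfulSMul.algebraMap_injective R K
  haveI : CharZero K := charZero_of_injective_algebraMap hinj
  have hK : Squarefree (P.map (algebraMap R K)) := by
    intro Q hQ
    have hQ0 : Q ≠ 0 := by
      rintro rfl
      simp at hQ
      exact (hP.map (algebraMap R K)).ne_zero hQ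
    obtain ⟨q, hq⟩ := IsIntegrallyClosed.eq_map_mul_C_of_dvd K hP ((dvd_mul_right _ _).trans hQ)
    have hlc : Q.leadingCoeff ≠ 0 := Polynomial.leadingCoeff_ne_zero.2 hQ0
    have hu : IsUnit (Polynomial.C Q.leadingCoeff) := Polynomial.isUnit_C.2 hlc.isUnit
    have hqm : q.Monic := by
      have : (q.map (algebraMap R K)).Monic := by
        have h := congrArg Polynomial.leadingCoeff hq
        rw [Polynomial.leadingCoeff_mul, Polynomial.leadingCoeff_C] at h
        exact mul_right_cancel₀ hlc (by rw [h, one_mul])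
      exact Polynomial.monic_of_injective hinj this
    have : (q * q).map (algebraMap R K) ∣ P.map (algebraMap R K) := by
      rw [Polynomial.map_mul]
      refine (mul_dvd_mul ?_ ?_).trans hQ <;> exact ⟨_, hq.symm⟩
    rw [Polynomial.map_dvd_map _ hinj (hqm.mul hqm)] at this
    have := hsf q this
    rw [← hq]
    exact ((this.map (Polynomial.mapRingHom (algebraMap R K)))).mul hu
  have hsep := PerfectField.separable_iff_squarefree.2 hK
  obtain ⟨a, b, hab⟩ := hsep
  obtain ⟨b1, hb1⟩ := IsLocalization.integerNormalization_map_to_map (nonZeroDivisors R) a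
  obtain ⟨b2, hb2⟩ := IsLocalization.integerNormalization_map_to_map (nonZeroDivisors R) b
  set A := IsLocalization.integerNormalization (nonZeroDivisors R) a
  set B := IsLocalization.integerNormalization (nonZeroDivisors R) b
  refine ⟨Polynomial.C (b2 : R) * A, Polynomial.C (b1 : R) * B, b1 * b2,
    mul_ne_zero (nonZeroDivisors.ne_zero b1.2) (nonZeroDivisors.ne_zero b2.2), ?_⟩
  apply Polynomial.map_injective _ hinj
  rw [Polynomial.derivative_map] at hab
  simp only [Polynomial.map_add, Polynomial.map_mul, Polynomial.map_C, map_mul]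
  have e1 : A.map (algebraMap R K) = Polynomial.C (algebraMap R K b1) * a := by
    rw [hb1, Algebra.smul_def]; rfl
  have e2 : B.map (algebraMap R K) = Polynomial.C (algebraMap R K b2) * b := by
    rw [hb2, Algebra.smul_def]; rfl
  rw [e1, e2]
  linear_combination (Polynomial.C (algebraMap R K b1) * Polynomial.C (algebraMap R K b2)) * hab

/-- scaling -/
noncomputable def tau {n : ℕ} :
    MvPolynomial (Fin n) ℂ →ₐ[ℂ] Polynomial (MvPolynomial (Fin n) ℂ) :=
  MvPolynomial.aeval (fun i => Polynomial.C (MvPolynomial.X i) * Polynomial.X)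

lemma ev2_tau {n : ℕ} (x : Fin n → ℂ) (t : ℂ) (g : MvPolynomial (Fin n) ℂ) :
    ev2 x t (tau g) = MvPolynomial.eval (t • x) g := by
  have : (ev2 x t).comp tau.toRingHom = MvPolynomial.eval (t • x) := by
    apply MvPolynomial.ringHom_ext
    · intro r
      simp [ev2, tau, Polynomial.algebraMap_eq, MvPolynomial.algebraMap_eq]
    · intro i
      simp [ev2, tau]
      ring
  exact congrArg (fun F : _ →+* ℂ => F g) this

lemma tau_one {n : ℕ} (g : MvPolynomial (Fin n) ℂ) : (tau g).eval 1 = g := by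
  have : (Polynomial.evalRingHom (1 : MvPolynomial (Fin n) ℂ)).comp tau.toRingHom = RingHom.id _ := by
    apply MvPolynomial.ringHom_ext
    · intro r
      simp [tau, MvPolynomial.algebraMap_eq]
    · intro i
      simp [tau]
  exact congrArg (fun F : _ →+* MvPolynomial (Fin n) ℂ => F g) this

lemma tau_hom {n : ℕ} (g : MvPolynomial (Fin n) ℂ) (d : ℕ) (hg : g.IsHomogeneous d) :
    tau g = Polynomial.C g * Polynomial.X ^ d := by
  conv_lhs => rw [g.as_sum, map_sum]
  conv_rhs => rw [g.as_sum, map_sum, Finset.sum_mul]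
  refine Finset.sum_congr rfl fun m hm => ?_
  have hd : ∑ i, m i = d := by
    have := hg (MvPolynomial.mem_support_iff.1 hm)
    rw [← this, ← Finsupp.degree_eq_sum, Finsupp.degree_eq_weight_one]
    rfl
  rw [tau, MvPolynomial.aeval_monomial, Finsupp.prod_fintype _ _ (by simp)]
  simp only [mul_pow, Finset.prod_mul_distrib, Finset.prod_pow_eq_pow_sum, hd]
  rw [← mul_assoc]
  congr 1
  rw [MvPolynomial.monomial_eq, Finsupp.prod_fintype _ _ (by simp)]
  simp [Polynomial.algebraMap_eq, MvPolynomial.algebraMap_eq]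

lemma factor_hom {n : ℕ} (f p : MvPolynomial (Fin n) ℂ) (d : ℕ) (hf : f.IsHomogeneous d)
    (hf0 : f ≠ 0) (hp : p ∣ f) :
    ∃ a : ℕ, ∀ (t : ℂ) (x : Fin n → ℂ), MvPolynomial.eval (t • x) p = t ^ a * MvPolynomial.eval x p := by
  obtain ⟨q, rfl⟩ := hp
  have h := tau_hom _ d hf
  rw [map_mul] at h
  have hinj : ∀ g : MvPolynomial (Fin n) ℂ, g ≠ 0 → tau g ≠ 0 := by
    intro g hg h0
    apply hg
    rw [← tau_one g, h0, Polynomial.eval_zero]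
  have hp0 := hinj p (left_ne_zero_of_mul hf0)
  have hq0 := hinj q (right_ne_zero_of_mul hf0)
  have h1 := congrArg Polynomial.natDegree h
  have h2 := congrArg Polynomial.natTrailingDegree h
  rw [Polynomial.natDegree_mul hp0 hq0, Polynomial.natDegree_C_mul_X_pow _ _ hf0] at h1
  rw [Polynomial.natTrailingDegree_mul hp0 hq0, Polynomial.C_mul_X_pow_eq_monomial,
    Polynomial.natTrailingDegree_monomial hf0] at h2
  have h3 := Polynomial.natTrailingDegree_le_natDegree (tau p)
  have h4 := Polynomial.natTrailingDegree_le_natDegree (tau q)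
  have h5 : (tau p).natTrailingDegree = (tau p).natDegree := by omega
  set a := (tau p).natDegree
  have h6 : tau p = Polynomial.C ((tau p).coeff a) * Polynomial.X ^ a := by
    ext1 k
    rw [Polynomial.coeff_C_mul_X_pow]
    split_ifs with hk
    · rw [hk]
    · rcases lt_or_gt_of_ne hk with hk | hk
      · exact Polynomial.coeff_eq_zero_of_lt_natTrailingDegree (by omega)
      · exact Polynomial.coeff_eq_zero_of_natDegree_lt hk
  have h7 : (tau p).coeff a = p := by
    have := tau_one p
    rw [h6] at this
    simpa using this
  refine ⟨a, fun t x => ?_⟩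
  rw [← ev2_tau, h6, h7]
  simp [ev2]
  ring

lemma circ_stable {E : Type*} [TopologicalSpace E] (Ω : Set (E × ℂ)) (hΩ : IsOpen Ω)
    (u : E × ℂ → ℂ) (hu : ContinuousOn u Ω) (h0 : ∀ p ∈ Ω, u p ≠ 0) (x₀ : E) (α : ℂ) (r : ℝ) (m : ℤ)
    (hc : ∀ z : Circle, (x₀, α + r * (z : ℂ)) ∈ Ω)
    (hd : HasDeg (fun z => u (x₀, α + r * (z : ℂ))) m) :
    ∀ᶠ x in 𝓝 x₀, (∀ z : Circle, (x, α + r * (z : ℂ)) ∈ Ω) ∧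
      HasDeg (fun z => u (x, α + r * (z : ℂ))) m := by
  have hcu : ∀ x, (∀ z : Circle, (x, α + r * (z : ℂ)) ∈ Ω) →
      Continuous (fun z : Circle => u (x, α + r * (z : ℂ))) := by
    intro x hx
    exact hu.comp_continuous (by fun_prop) hx
  have key : ∀ᶠ x in 𝓝 x₀, ∀ z ∈ (Set.univ : Set Circle), (x, α + r * (z : ℂ)) ∈ Ω ∧
      ‖u (x, α + r * (z : ℂ)) - u (x₀, α + r * (z : ℂ))‖ < ‖u (x₀, α + r * (z : ℂ))‖ := by
    apply isCompact_univ.eventually_forall_of_forall_eventually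
    intro z _
    have hct : ContinuousAt (fun p : E × Circle => (p.1, α + r * (p.2 : ℂ))) (x₀, z) := by fun_prop
    have h1 : ∀ᶠ p : E × Circle in 𝓝 (x₀, z), (p.1, α + r * (p.2 : ℂ)) ∈ Ω :=
      hct.eventually (hΩ.mem_nhds (hc z))
    have h2 : ContinuousAt (fun p : E × Circle => u (p.1, α + r * (p.2 : ℂ))) (x₀, z) :=
      ContinuousAt.comp (f := fun p : E × Circle => (p.1, α + r * (p.2 : ℂ)))
        (hu.continuousAt (hΩ.mem_nhds (hc z))) hct
    have h3 : ContinuousAt (fun p : E × Circle => u (x₀, α + r * (p.2 : ℂ))) (x₀, z) :=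
      ((hcu x₀ hc).comp continuous_snd).continuousAt
    have h4 := (h2.sub h3).norm.eventually_lt h3.norm (by
      simpa using h0 _ (hc z))
    filter_upwards [h1, h4] with p hp hp2 using ⟨hp, hp2⟩
  filter_upwards [key] with x hx
  exact ⟨fun z => (hx z trivial).1, hd.near (hcu x₀ hc) (hcu x fun z => (hx z trivial).1)
    fun z => (hx z trivial).2⟩

lemma glue_log {E : Type*} [NormedAddCommGroup E] [NormedSpace ℝ E] (Ω : Set (E × ℂ)) (hΩ : IsOpen Ω)
    (R : E → Finset ℂ) (hR : ∀ x t, (x, t) ∈ Ω ↔ t ∉ R x)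
    (u : E × ℂ → ℂ) (hu : ContinuousOn u Ω) (h0 : ∀ p ∈ Ω, u p ≠ 0)
    (t₀ : E → ℂ) (ht : Continuous t₀) (ht0 : ∀ x, (x, t₀ x) ∈ Ω)
    (hh : ∀ x, ∃ h : ℂ → ℂ, ContinuousOn h (R x : Set ℂ)ᶜ ∧ ∀ t ∉ R x, u (x, t) = Complex.exp (h t)) :
    ∃ H : E × ℂ → ℂ, ContinuousOn H Ω ∧ ∀ p ∈ Ω, u p = Complex.exp (H p) := by
  choose h hh1 hh2 using hh
  obtain ⟨l, hl, hl1⟩ := log_normed (fun x => u (x, t₀ x))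
    (hu.comp_continuous (by fun_prop) ht0) (fun x => h0 _ (ht0 x))
  let H : E × ℂ → ℂ := fun p => h p.1 p.2 + (l p.1 - h p.1 (t₀ p.1))
  have hH : ∀ p ∈ Ω, u p = Complex.exp (H p) := by
    rintro ⟨x, t⟩ hp
    simp only [H]
    rw [Complex.exp_add, Complex.exp_sub, hl1, ← hh2 x _ ((hR _ _).1 (ht0 x)),
      div_self (h0 _ (ht0 x)), mul_one, ← hh2 x t ((hR _ _).1 hp)]
  refine ⟨H, ?_, hH⟩
  rintro ⟨x₀, t₁⟩ hp
  apply ContinuousAt.continuousWithinAt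
  have hpc : IsPathConnected ((R x₀ : Set ℂ)ᶜ) :=
    (R x₀).countable_toSet.isPathConnected_compl_of_one_lt_rank
      (by rw [Complex.rank_real_complex]; norm_num)
  obtain ⟨γ, hγ⟩ := hpc.joinedIn (t₀ x₀) ((hR _ _).1 (ht0 x₀)) t₁ ((hR _ _).1 hp)
  let G : (E × ℂ) → I → E × ℂ := fun a s =>
    (a.1, γ s + (1 - ((s : ℝ) : ℂ)) * (t₀ a.1 - t₀ x₀) + ((s : ℝ) : ℂ) * (a.2 - t₁))
  have hG : Continuous (fun p : I × (E × ℂ) => G p.2 p.1) := by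
    simp only [G]; fun_prop
  have hG' : Continuous (fun p : (E × ℂ) × I => G p.1 p.2) := hG.comp continuous_swap
  have ev : ∀ᶠ a in 𝓝 (x₀, t₁), ∀ s ∈ (Set.univ : Set I), G a s ∈ Ω := by
    apply isCompact_univ.eventually_forall_of_forall_eventually
    intro s _
    apply hG'.continuousAt.eventually
    apply hΩ.mem_nhds
    simp only [G, sub_self, mul_zero, add_zero]
    exact (hR _ _).2 (hγ s)
  obtain ⟨A, hA, hAo, hAm⟩ := eventually_nhds_iff.1 ev
  obtain ⟨k, hk, hk1, hk0⟩ := hlog (A := A) (fun a s => u (G a s))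
    (hu.comp_continuous (hG.comp (by fun_prop : Continuous fun p : I × A => (p.1, (p.2 : E × ℂ))))
      (fun p => hA _ p.2.2 _ trivial)) (fun a s => h0 _ (hA _ a.2 _ trivial)) (fun a => l a.1.1)
    (by fun_prop) (by
      intro a
      rw [hl1]
      simp [G])
  have key : ∀ a : A, H a = k a 1 := by
    intro a
    have c1 : Continuous (fun s : I => H (G a s)) := by
      have hGf : ∀ s, (G a s).1 = a.1.1 := fun _ => rfl
      simp only [H, hGf]
      refine Continuous.add ?_ continuous_const
      have : ContinuousOn (h a.1.1) (R a.1.1 : Set ℂ)ᶜ := hh1 _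
      refine this.comp_continuous (f := fun s => (G a s).2) ?_ ?_
      · exact continuous_snd.comp (hG.comp (by fun_prop : Continuous fun s : I => (s, (a : E × ℂ))))
      · intro s
        exact (hR _ _).1 (hA _ a.2 s trivial)
    have c2 : Continuous (fun s : I => k a s) :=
      hk.comp (by fun_prop : Continuous fun s : I => (s, a))
    have := int_const (fun s : I => H (G a s) - k a s) (c1.sub c2) (by
      intro s
      rw [Complex.exp_sub, hk1, ← hH _ (hA _ a.2 s trivial), div_self (h0 _ (hA _ a.2 s trivial))]) 1 0
    have e0 : G a 0 = (a.1.1, t₀ a.1.1) := by simp [G]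
    have e1 : G a 1 = a := by simp [G]
    beta_reduce at this
    rw [e0, e1, hk0] at this
    have e2 : H (a.1.1, t₀ a.1.1) = l a.1.1 := by simp [H]
    rw [e2, sub_self, sub_eq_zero] at this
    exact this
  have hcA : ContinuousOn H A := by
    rw [continuousOn_iff_continuous_domRestrict]
    have : A.domRestrict H = fun a => k a 1 := funext key
    rw [this]
    exact hk.comp (by fun_prop : Continuous fun a : A => ((1 : I), a))
  exact hcA.continuousAt (hAo.mem_nhds hAm)

noncomputable def Rt {n : ℕ} (P : Polynomial (MvPolynomial (Fin n) ℂ)) (x : Fin n → ℂ) : Finset ℂ :=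
  (P.map (MvPolynomial.eval x)).roots.toFinset

lemma mem_Rt {n : ℕ} {P : Polynomial (MvPolynomial (Fin n) ℂ)} (hP : P.Monic) (x : Fin n → ℂ) (t : ℂ) :
    t ∈ Rt P x ↔ ev2 x t P = 0 := by
  rw [Rt, Multiset.mem_toFinset, Polynomial.mem_roots (hP.map _).ne_zero, ev2_eq, Polynomial.IsRoot]

lemma ev2_contDiff {n : ℕ} (P : Polynomial (MvPolynomial (Fin n) ℂ)) :
    ContDiff ℂ 1 (fun p : (Fin n → ℂ) × ℂ => ev2 p.1 p.2 P) := by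
  have : (fun p : (Fin n → ℂ) × ℂ => ev2 p.1 p.2 P) = fun p : (Fin n → ℂ) × ℂ =>
      ∑ i ∈ Finset.range (P.natDegree + 1), MvPolynomial.eval p.1 (P.coeff i) * p.2 ^ i := by
    ext p
    simp only [ev2, Polynomial.coe_eval₂RingHom]
    rw [Polynomial.eval₂_eq_sum_range]
  rw [this]
  refine ContDiff.sum fun i _ => ContDiff.mul ?_ (contDiff_snd.pow i)
  have h : ContDiff ℂ 1 (fun x : Fin n → ℂ => MvPolynomial.eval x (P.coeff i)) := by
    have := AnalyticOnNhd.eval_mvPolynomial (𝕜 := ℂ) (P.coeff i)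
    exact this.contDiff
  exact h.comp contDiff_fst

lemma ev2_cont {n : ℕ} (P : Polynomial (MvPolynomial (Fin n) ℂ)) :
    Continuous (fun p : (Fin n → ℂ) × ℂ => ev2 p.1 p.2 P) := (ev2_contDiff P).continuous

lemma ev2_deriv {n : ℕ} (P : Polynomial (MvPolynomial (Fin n) ℂ)) (x : Fin n → ℂ) (t : ℂ) :
    HasDerivAt (fun t => ev2 x t P) (ev2 x t P.derivative) t := by
  simp only [ev2_eq]
  rw [← Polynomial.derivative_map]
  exact Polynomial.hasDerivAt _ _

lemma root_fun {n : ℕ} (P : Polynomial (MvPolynomial (Fin n) ℂ)) (x₀ : Fin n → ℂ) (α : ℂ)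
    (h : ev2 x₀ α P = 0) (h' : ev2 x₀ α P.derivative ≠ 0) :
    ∃ a : (Fin n → ℂ) → ℂ, DifferentiableAt ℂ a x₀ ∧ a x₀ = α ∧ ∀ᶠ x in 𝓝 x₀, ev2 x (a x) P = 0 := by
  have cd : ContDiffAt ℂ 1 (fun p : (Fin n → ℂ) × ℂ => ev2 p.1 p.2 P) (x₀, α) :=
    (ev2_contDiff P).contDiffAt
  have hinv : (fderiv ℂ (fun p : (Fin n → ℂ) × ℂ => ev2 p.1 p.2 P) (x₀, α) ∘L
      ContinuousLinearMap.inr ℂ (Fin n → ℂ) ℂ).IsInvertible := by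
    have h1 : HasFDerivAt (fun t : ℂ => ev2 x₀ t P)
        (fderiv ℂ (fun p : (Fin n → ℂ) × ℂ => ev2 p.1 p.2 P) (x₀, α) ∘L
      ContinuousLinearMap.inr ℂ (Fin n → ℂ) ℂ) α := by
      have hd := (cd.differentiableAt one_ne_zero).hasFDerivAt
      have h2 : HasFDerivAt (fun t : ℂ => (x₀, t)) (ContinuousLinearMap.inr ℂ (Fin n → ℂ) ℂ) α :=
        hasFDerivAt_prodMk_right x₀ α
      exact HasFDerivAt.comp (f := fun t : ℂ => (x₀, t)) α hd h2
    have h3 := h1.unique (ev2_deriv P x₀ α).hasFDerivAt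
    rw [h3]
    refine ⟨ContinuousLinearEquiv.unitsEquivAut ℂ (Units.mk0 _ h'), ?_⟩
    ext
    simp
  refine ⟨cd.implicitFunction one_ne_zero hinv,
    (cd.hasStrictFDerivAt_implicitFunction one_ne_zero hinv).hasFDerivAt.differentiableAt,
    cd.implicitFunction_apply_self one_ne_zero hinv, ?_⟩
  have := cd.eventually_apply_implicitFunction one_ne_zero hinv
  simpa only [h] using this

/-- discs separating a finite set -/
lemma sep_radius (F : Finset ℂ) : ∃ r : ℝ, 0 < r ∧ ∀ α ∈ F, ∀ β ∈ F, ‖β - α‖ ≤ 2 * r → β = α := by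
  classical
  have : ∀ᶠ r : ℝ in 𝓝[>] 0, ∀ p ∈ F ×ˢ F, p.2 ≠ p.1 → 2 * r < ‖p.2 - p.1‖ := by
    rw [Filter.eventually_all_finset]
    intro p _
    by_cases hp : p.2 = p.1
    · simp [hp]
    · have h1 : 0 < ‖p.2 - p.1‖ := norm_pos_iff.2 (sub_ne_zero.2 hp)
      have : ∀ᶠ r : ℝ in 𝓝 0, 2 * r < ‖p.2 - p.1‖ := by
        have hc : ContinuousAt (fun r : ℝ => 2 * r) 0 := by fun_prop
        exact hc.eventually_lt continuousAt_const (by simpa using h1)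
      filter_upwards [nhdsWithin_le_nhds this] with r hr _ using hr
  obtain ⟨r, hr, hr0⟩ := (this.and self_mem_nhdsWithin).exists
  refine ⟨r, hr0, fun α hα β hβ h => ?_⟩
  by_contra hne
  exact absurd (hr (α, β) (by simp [hα, hβ]) hne) (not_lt.2 h)

lemma card_Rt {n : ℕ} {P : Polynomial (MvPolynomial (Fin n) ℂ)} (hP : P.Monic) (x : Fin n → ℂ)
    (hs : ∀ t, ev2 x t P = 0 → ev2 x t P.derivative ≠ 0) :
    (Rt P x).card = P.natDegree ∧ (P.map (MvPolynomial.eval x)).roots.Nodup := by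
  have h0 := (hP.map (MvPolynomial.eval x)).ne_zero
  have hn : (P.map (MvPolynomial.eval x)).roots.Nodup := by
    rw [Multiset.nodup_iff_count_le_one]
    intro t
    rw [Polynomial.count_roots]
    by_contra hlt
    push Not at hlt
    have := (Polynomial.one_lt_rootMultiplicity_iff_isRoot h0).1 hlt
    apply hs t
    · rw [ev2_eq]; exact this.1
    · rw [ev2_eq, ← Polynomial.derivative_map]; exact this.2
  refine ⟨?_, hn⟩
  rw [Rt, Multiset.toFinset_card_of_nodup hn, ← (IsAlgClosed.splits _).natDegree_eq_card_roots, hP.natDegree_map]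

lemma card_Rt_le {n : ℕ} {P : Polynomial (MvPolynomial (Fin n) ℂ)} (hP : P.Monic) (x : Fin n → ℂ) :
    (Rt P x).card ≤ P.natDegree := by
  rw [Rt]
  refine (Multiset.toFinset_card_le _).trans ((Polynomial.card_roots' _).trans ?_)
  rw [hP.natDegree_map]

lemma Om_open {n : ℕ} (P : Polynomial (MvPolynomial (Fin n) ℂ)) :
    IsOpen {p : (Fin n → ℂ) × ℂ | ev2 p.1 p.2 P ≠ 0} :=
  isOpen_ne_fun (ev2_cont P) continuous_const

/-- exponents data -/
structure Expo {n : ℕ} (P : Polynomial (MvPolynomial (Fin n) ℂ)) (u : (Fin n → ℂ) × ℂ → ℂ)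
    (c : (Fin n → ℂ) → ℂ → ℤ) (h : (Fin n → ℂ) → ℂ → ℂ) : Prop where
  mon : P.Monic
  cont : ContinuousOn u {p : (Fin n → ℂ) × ℂ | ev2 p.1 p.2 P ≠ 0}
  ne : ∀ p : (Fin n → ℂ) × ℂ, ev2 p.1 p.2 P ≠ 0 → u p ≠ 0
  hc : ∀ x, ContinuousOn (h x) (Rt P x : Set ℂ)ᶜ
  he : ∀ x, ∀ t ∉ Rt P x, u (x, t) = Complex.exp (h x t) * ∏ α ∈ Rt P x, (t - α) ^ c x α

lemma exists_expo {n : ℕ} (P : Polynomial (MvPolynomial (Fin n) ℂ)) (hP : P.Monic) (u : (Fin n → ℂ) × ℂ → ℂ)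
    (hu : ContinuousOn u {p : (Fin n → ℂ) × ℂ | ev2 p.1 p.2 P ≠ 0})
    (h0 : ∀ p : (Fin n → ℂ) × ℂ, ev2 p.1 p.2 P ≠ 0 → u p ≠ 0) : ∃ c h, Expo P u c h := by
  have : ∀ x, ∃ (c : ℂ → ℤ) (h : ℂ → ℂ), ContinuousOn h (Rt P x : Set ℂ)ᶜ ∧
      ∀ t ∉ Rt P x, u (x, t) = Complex.exp (h t) * ∏ α ∈ Rt P x, (t - α) ^ c α := by
    intro x
    refine fibre_log (Rt P x) (fun t => u (x, t)) ?_ ?_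
    · refine hu.comp (by fun_prop) ?_
      intro t ht h
      exact ht ((mem_Rt hP _ _).2 h)
    · intro t ht
      exact h0 _ (fun h => ht ((mem_Rt hP _ _).2 h))
  choose c h hc he using this
  exact ⟨c, h, hP, hu, h0, hc, he⟩

lemma Expo.deg {n : ℕ} {P : Polynomial (MvPolynomial (Fin n) ℂ)} {u c h} (H : Expo (n := n) P u c h)
    (x : Fin n → ℂ) (α : ℂ) (r : ℝ) (hr : 0 < r) (hc : ∀ z : Circle, ev2 x (α + r * (z : ℂ)) P ≠ 0) :
    HasDeg (fun z => u (x, α + r * (z : ℂ))) (∑ β ∈ Rt P x with ‖β - α‖ < r, c x β) := by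
  refine fibre_deg (Rt P x) (fun t => u (x, t)) (h x) (c x) (H.hc x) (H.he x) α r hr ?_
  intro β hβ hb
  have hr' : (r : ℂ) ≠ 0 := by exact_mod_cast hr.ne'
  let z : Circle := ⟨(β - α) / r, by
    change (β - α) / r ∈ Metric.sphere (0 : ℂ) 1
    rw [mem_sphere_zero_iff_norm, norm_div, hb, Complex.norm_real, Real.norm_of_nonneg hr.le, div_self hr.ne']⟩
  apply hc z
  have : α + r * (z : ℂ) = β := by
    simp only [z]
    field_simp
    ring
  rw [this]
  exact (mem_Rt H.mon _ _).1 hβ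

/-- stability near a generic point -/
lemma Expo.stable {n : ℕ} {P : Polynomial (MvPolynomial (Fin n) ℂ)} {u c h} (H : Expo (n := n) P u c h)
    (x₀ : Fin n → ℂ) (hs : ∀ t, ev2 x₀ t P = 0 → ev2 x₀ t P.derivative ≠ 0) :
    ∃ a : ℂ → (Fin n → ℂ) → ℂ, (∀ α ∈ Rt P x₀, DifferentiableAt ℂ (a α) x₀) ∧
      ∀ᶠ x in 𝓝 x₀, Set.InjOn (fun α => a α x) (Rt P x₀) ∧
        Rt P x = (Rt P x₀).image (fun α => a α x) ∧ ∀ α ∈ Rt P x₀, c x (a α x) = c x₀ α := by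
  classical
  have : ∀ α, ∃ a : (Fin n → ℂ) → ℂ, α ∈ Rt P x₀ → DifferentiableAt ℂ a x₀ ∧ a x₀ = α ∧
      ∀ᶠ x in 𝓝 x₀, ev2 x (a x) P = 0 := by
    intro α
    by_cases hα : α ∈ Rt P x₀
    · have h1 := (mem_Rt H.mon _ _).1 hα
      obtain ⟨a, ha⟩ := root_fun P x₀ α h1 (hs α h1)
      exact ⟨a, fun _ => ha⟩
    · exact ⟨fun _ => 0, fun h => absurd h hα⟩
  choose a ha using this
  obtain ⟨r, hr, hsep⟩ := sep_radius (Rt P x₀)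
  have hcirc : ∀ α ∈ Rt P x₀, ∀ z : Circle, ev2 x₀ (α + r * (z : ℂ)) P ≠ 0 := by
    intro α hα z hz
    have hn : ‖(α + r * (z : ℂ)) - α‖ = r := by
      rw [add_sub_cancel_left, norm_mul, Circle.norm_coe, Complex.norm_real, Real.norm_of_nonneg hr.le, mul_one]
    have := hsep α hα _ ((mem_Rt H.mon _ _).2 hz) (by rw [hn]; linarith)
    rw [this, sub_self, norm_zero] at hn
    exact hr.ne hn
  refine ⟨a, fun α hα => (ha α hα).1, ?_⟩
  have e1 : ∀ᶠ x in 𝓝 x₀, ∀ α ∈ Rt P x₀, ev2 x (a α x) P = 0 ∧ ‖a α x - α‖ < r ∧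
      (∀ z : Circle, ev2 x (α + r * (z : ℂ)) P ≠ 0) ∧
      HasDeg (fun z => u (x, α + r * (z : ℂ))) (c x₀ α) := by
    rw [Filter.eventually_all_finset]
    intro α hα
    obtain ⟨hd, h1, h2⟩ := ha α hα
    have h3 : ∀ᶠ x in 𝓝 x₀, ‖a α x - α‖ < r := by
      have : ContinuousAt (fun x => ‖a α x - α‖) x₀ := (hd.continuousAt.sub continuousAt_const).norm
      exact this.eventually_lt continuousAt_const (by simpa [h1] using hr)
    have hdeg := H.deg x₀ α r hr (hcirc α hα)
    have hsum : ∑ β ∈ Rt P x₀ with ‖β - α‖ < r, c x₀ β = c x₀ α := by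
      have : (Rt P x₀).filter (fun β => ‖β - α‖ < r) = {α} := by
        ext β
        simp only [Finset.mem_filter, Finset.mem_singleton]
        constructor
        · rintro ⟨hb, hb2⟩
          exact hsep α hα β hb (by linarith)
        · rintro rfl
          simpa using ⟨hα, hr⟩
      rw [this, Finset.sum_singleton]
    rw [hsum] at hdeg
    have h4 := circ_stable _ (Om_open P) u H.cont H.ne x₀ α r _ (hcirc α hα) hdeg
    filter_upwards [h2, h3, h4] with x k2 k3 k4 using ⟨k2, k3, k4.1, k4.2⟩
  filter_upwards [e1] with x hx
  have hinj : Set.InjOn (fun α => a α x) (Rt P x₀) := by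
    intro α hα β hβ hab
    simp only at hab
    apply (hsep α hα β hβ _).symm
    have h1 := (hx α hα).2.1
    have h2 := (hx β hβ).2.1
    calc ‖β - α‖ = ‖(a α x - α) - (a β x - β)‖ := by rw [hab]; ring_nf
      _ ≤ _ := norm_sub_le _ _
      _ ≤ _ := by linarith
  have himg : (Rt P x₀).image (fun α => a α x) = Rt P x := by
    apply Finset.eq_of_subset_of_card_le
    · intro β hβ
      obtain ⟨α, hα, rfl⟩ := Finset.mem_image.1 hβ
      exact (mem_Rt H.mon _ _).2 (hx α hα).1
    · rw [Finset.card_image_of_injOn hinj, (card_Rt H.mon x₀ hs).1]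
      exact card_Rt_le H.mon x
  refine ⟨hinj, himg.symm, fun α hα => ?_⟩
  obtain ⟨k1, k2, k3, k4⟩ := hx α hα
  have hdeg := H.deg x α r hr k3
  have hsum : ∑ β ∈ Rt P x with ‖β - α‖ < r, c x β = c x (a α x) := by
    have : (Rt P x).filter (fun β => ‖β - α‖ < r) = {a α x} := by
      ext β
      simp only [Finset.mem_filter, Finset.mem_singleton, ← himg, Finset.mem_image]
      constructor
      · rintro ⟨⟨γ, hγ, rfl⟩, hb2⟩
        have : γ = α := by
          apply hsep α hα γ hγ
          have h1 := (hx γ hγ).2.1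
          calc ‖γ - α‖ = ‖(a γ x - α) - (a γ x - γ)‖ := by ring_nf
            _ ≤ _ := norm_sub_le _ _
            _ ≤ _ := by linarith
        rw [this]
      · rintro rfl
        exact ⟨⟨α, hα, rfl⟩, k2⟩
    rw [this, Finset.sum_singleton]
  rw [hsum] at hdeg
  exact hdeg.unique k4

lemma line_fin {n : ℕ} (x w : Fin n → ℂ) (D : MvPolynomial (Fin n) ℂ) (s₀ : ℂ)
    (h : MvPolynomial.eval (x + s₀ • w) D ≠ 0) :
    {s : ℂ | MvPolynomial.eval (x + s • w) D = 0}.Finite := by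
  simp only [← ev2_sh, ev2_eq] at h ⊢
  set q := (sh w D).map (MvPolynomial.eval x)
  have hq : q ≠ 0 := by
    intro h0
    rw [h0] at h
    simp at h
  refine (q.roots.toFinset.finite_toSet).subset fun s hs => ?_
  simpa [hq] using hs

lemma exists_eval_ne {n : ℕ} (D : MvPolynomial (Fin n) ℂ) (hD : D ≠ 0) : ∃ x, MvPolynomial.eval x D ≠ 0 := by
  by_contra h
  push Not at h
  exact hD (MvPolynomial.funext (by simpa using h))

lemma Expo.M_const {n : ℕ} {P : Polynomial (MvPolynomial (Fin n) ℂ)} {u c h} (H : Expo (n := n) P u c h)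
    (D : MvPolynomial (Fin n) ℂ) (hD : D ≠ 0)
    (hs : ∀ x, MvPolynomial.eval x D ≠ 0 → ∀ t, ev2 x t P = 0 → ev2 x t P.derivative ≠ 0) :
    ∃ M : Finset ℤ, ∀ x, MvPolynomial.eval x D ≠ 0 → (Rt P x).image (c x) = M := by
  obtain ⟨x₀, hx₀⟩ := exists_eval_ne D hD
  refine ⟨(Rt P x₀).image (c x₀), fun x hx => ?_⟩
  let w := x - x₀
  let Z : Set ℂ := {s : ℂ | MvPolynomial.eval (x₀ + s • w) D = 0}
  have hZ : Z.Finite := line_fin x₀ w D 0 (by simpa using hx₀)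
  have hpc : IsPathConnected Zᶜ :=
    hZ.countable.isPathConnected_compl_of_one_lt_rank
      (by rw [Complex.rank_real_complex]; norm_num)
  have : PreconnectedSpace (Zᶜ : Set ℂ) :=
    Subtype.preconnectedSpace hpc.isConnected.isPreconnected
  let F : (Zᶜ : Set ℂ) → Finset ℤ := fun s => (Rt P (x₀ + (s : ℂ) • w)).image (c (x₀ + (s : ℂ) • w))
  have hF : IsLocallyConstant F := by
    rw [IsLocallyConstant.iff_eventually_eq]
    intro s
    obtain ⟨a, -, ha⟩ := H.stable (x₀ + (s : ℂ) • w) (hs _ s.2)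
    have hct : ContinuousAt (fun s : (Zᶜ : Set ℂ) => x₀ + (s : ℂ) • w) s := by fun_prop
    filter_upwards [hct.eventually ha] with s' hs'
    simp only [F]
    rw [hs'.2.1, Finset.image_image]
    exact Finset.image_congr fun α hα => hs'.2.2 α hα
  have := hF.apply_eq_of_preconnectedSpace ⟨1, by simpa [Z, w] using hx⟩ ⟨0, by simpa [Z, w] using hx₀⟩
  simpa [F, w] using this

lemma Expo.S_poly {n : ℕ} {P : Polynomial (MvPolynomial (Fin n) ℂ)} {u c h} (H : Expo (n := n) P u c h)
    (D : MvPolynomial (Fin n) ℂ) (hD : D ≠ 0)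
    (hs : ∀ x, MvPolynomial.eval x D ≠ 0 → ∀ t, ev2 x t P = 0 → ev2 x t P.derivative ≠ 0)
    (C : ℝ) (hC0 : 0 ≤ C) (hC : ∀ x t, ev2 x t P = 0 → ‖t‖ ≤ C * (1 + ‖x‖)) (j : ℕ) :
    ∃ Q D' : MvPolynomial (Fin n) ℂ, D' ≠ 0 ∧ ∀ x, MvPolynomial.eval x D' ≠ 0 →
      ∑ α ∈ Rt P x, (c x α : ℂ) * α ^ j = MvPolynomial.eval x Q := by
  obtain ⟨M, hM⟩ := H.M_const D hD hs
  obtain ⟨B, hB⟩ : ∃ B : ℝ, ∀ m ∈ M, ‖(m : ℂ)‖ ≤ B := by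
    refine ⟨∑ m ∈ M, ‖(m : ℂ)‖, fun m hm => ?_⟩
    exact Finset.single_le_sum (f := fun m : ℤ => ‖(m : ℂ)‖) (fun _ _ => norm_nonneg _) hm
  have hbd : ∀ x, MvPolynomial.eval x D ≠ 0 →
      ‖∑ α ∈ Rt P x, (c x α : ℂ) * α ^ j‖ ≤ P.natDegree * (|B| * (C * (1 + ‖x‖)) ^ j) := by
    intro x hx
    refine (norm_sum_le _ _).trans ?_
    have : ∀ α ∈ Rt P x, ‖(c x α : ℂ) * α ^ j‖ ≤ |B| * (C * (1 + ‖x‖)) ^ j := by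
      intro α hα
      rw [norm_mul, norm_pow]
      have h1 : ‖(c x α : ℂ)‖ ≤ |B| := (hB _ (by
        rw [← hM x hx]; exact Finset.mem_image_of_mem _ hα)).trans (le_abs_self B)
      have h2 := hC x α ((mem_Rt H.mon _ _).1 hα)
      gcongr
    refine (Finset.sum_le_card_nsmul _ _ _ this).trans ?_
    rw [nsmul_eq_mul]
    have hc := card_Rt_le H.mon x
    gcongr
  have hupd : ∀ (x : Fin n → ℂ) (i : Fin n) (s : ℂ),
      Function.update x i s = Function.update x i 0 + s • Pi.single i 1 := by
    intro x i s
    ext k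
    by_cases hk : k = i
    · subst hk; simp
    · simp [hk]
  refine mvpoly j n (fun x => ∑ α ∈ Rt P x, (c x α : ℂ) * α ^ j) D hD ?_
  intro x i
  by_cases hz : ∃ s₀, MvPolynomial.eval (Function.update x i s₀) D ≠ 0
  swap
  · push Not at hz
    exact ⟨0, by simp, fun s hs => absurd (hz s) hs⟩
  obtain ⟨s₀, hs₀⟩ := hz
  have hfin : {s : ℂ | MvPolynomial.eval (Function.update x i s) D = 0}.Finite := by
    rw [hupd x i] at hs₀
    refine (line_fin _ _ D s₀ hs₀).subset fun s hs => ?_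
    rw [Set.mem_ofPred_eq, hupd x i] at hs
    exact hs
  have hmem : ∀ s, s ∉ hfin.toFinset ↔ MvPolynomial.eval (Function.update x i s) D ≠ 0 := by
    intro s; simp
  refine Exists.imp (fun q hq => ⟨hq.1, fun s hs => hq.2 s ((hmem s).2 hs)⟩) (liou (fun s => ∑ α ∈ Rt P (Function.update x i s),
      (c (Function.update x i s) α : ℂ) * α ^ j) hfin.toFinset ?_
      (P.natDegree * (|B| * (C * (1 + ‖x‖)) ^ j)) j ?_)
  · intro s hsD
    rw [hmem] at hsD
    obtain ⟨a, had, ha⟩ := H.stable (Function.update x i s) (hs _ hsD)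
    have hup : DifferentiableAt ℂ (fun s => Function.update x i s) s :=
      (hasFDerivAt_update x s).differentiableAt
    have key : (fun s' => ∑ α ∈ Rt P (Function.update x i s'),
      (c (Function.update x i s') α : ℂ) * α ^ j) =ᶠ[𝓝 s] fun s' =>
        ∑ α ∈ Rt P (Function.update x i s), (c (Function.update x i s) α : ℂ) *
          (a α (Function.update x i s')) ^ j := by
      filter_upwards [hup.continuousAt.eventually ha] with s' hs'
      obtain ⟨h1, h2, h3⟩ := hs'
      rw [h2, Finset.sum_image h1]
      exact Finset.sum_congr rfl fun α hα => by rw [h3 α hα]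
    refine DifferentiableAt.congr_of_eventuallyEq ?_ key
    refine DifferentiableAt.fun_sum fun α hα => ?_
    refine (DifferentiableAt.pow ?_ j).const_mul _
    exact DifferentiableAt.comp (f := fun s => Function.update x i s) s (had α hα) hup
  · intro s hsD
    rw [hmem] at hsD
    refine (hbd _ hsD).trans ?_
    have hn : ‖Function.update x i s‖ ≤ ‖x‖ + ‖s‖ := by
      rw [pi_norm_le_iff_of_nonneg (by positivity)]
      intro k
      by_cases hk : k = i
      · subst hk; simp
      · simp [hk]
        have := norm_le_pi_norm x k
        linarith [norm_nonneg s]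
    have h2 : C * (1 + ‖Function.update x i s‖) ≤ C * (1 + ‖x‖) * (1 + ‖s‖) := by
      rw [mul_assoc]
      gcongr
      nlinarith [mul_nonneg (norm_nonneg x) (norm_nonneg s)]
    have h3 : (C * (1 + ‖Function.update x i s‖)) ^ j ≤ (C * (1 + ‖x‖)) ^ j * (1 + ‖s‖) ^ j := by
      rw [← mul_pow]
      gcongr
    calc _ ≤ (P.natDegree : ℝ) * (|B| * ((C * (1 + ‖x‖)) ^ j * (1 + ‖s‖) ^ j)) := by gcongr
      _ = _ := by ring

lemma dvd_of_vanish {n : ℕ} {P : Polynomial (MvPolynomial (Fin n) ℂ)} (hP : P.Monic)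
    (D : MvPolynomial (Fin n) ℂ) (hD : D ≠ 0)
    (hs : ∀ x, MvPolynomial.eval x D ≠ 0 → ∀ t, ev2 x t P = 0 → ev2 x t P.derivative ≠ 0)
    (G : Polynomial (MvPolynomial (Fin n) ℂ))
    (hG : ∀ x, MvPolynomial.eval x D ≠ 0 → ∀ t, ev2 x t P = 0 → ev2 x t G = 0) : P ∣ G := by
  rw [← Polynomial.modByMonic_eq_zero_iff_dvd hP]
  set r := G %ₘ P with hr
  have h1 : ∀ x, MvPolynomial.eval x D ≠ 0 → r.map (MvPolynomial.eval x) = 0 := by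
    intro x hx
    by_contra hne
    have hroot : ∀ t ∈ Rt P x, t ∈ (r.map (MvPolynomial.eval x)).roots.toFinset := by
      intro t ht
      rw [mem_Rt hP] at ht
      rw [Multiset.mem_toFinset, Polynomial.mem_roots hne, Polynomial.IsRoot, ← ev2_eq]
      have := congrArg (ev2 x t) (Polynomial.modByMonic_add_div G P)
      rw [map_add, map_mul, ht, zero_mul, add_zero, hG x hx t ht] at this
      exact this
    have hcard := Finset.card_le_card (s := Rt P x) (fun t ht => hroot t ht)
    rw [(card_Rt hP x (hs x hx)).1] at hcard
    have h2 := (Multiset.toFinset_card_le _).trans (Polynomial.card_roots' (r.map (MvPolynomial.eval x)))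
    have hlt : (r.map (MvPolynomial.eval x)).degree < P.degree :=
      (Polynomial.degree_map_le).trans_lt (Polynomial.degree_modByMonic_lt G hP)
    have := Polynomial.natDegree_lt_natDegree hne hlt
    omega
  ext1 k
  rw [Polynomial.coeff_zero]
  have : r.coeff k * D = 0 := by
    apply MvPolynomial.funext
    intro x
    rw [map_mul, map_zero]
    by_cases hx : MvPolynomial.eval x D = 0
    · rw [hx, mul_zero]
    · have := congrArg (fun q => Polynomial.coeff q k) (h1 x hx)
      simp only [Polynomial.coeff_map, Polynomial.coeff_zero] at this
      rw [this, zero_mul]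
  exact (mul_eq_zero.1 this).resolve_right hD

lemma lagr (p : Polynomial ℂ) (β α : ℂ) (hβ : p.eval β = 0) (hα : p.eval α = 0) :
    ∑ i ∈ Finset.range (p.natDegree + 1), p.coeff i * ∑ l ∈ Finset.range i, β ^ l * α ^ (i - 1 - l) =
      if β = α then p.derivative.eval α else 0 := by
  split_ifs with h
  · subst h
    rw [Polynomial.derivative_eval, Polynomial.sum_over_range _ (by simp)]
    refine Finset.sum_congr rfl fun i _ => ?_
    rw [mul_assoc]
    congr 1
    rw [Finset.sum_congr rfl (g := fun _ => β ^ (i - 1))]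
    · simp
    · intro l hl
      rw [Finset.mem_range] at hl
      rw [← pow_add]
      congr 1
      omega
  · have : (∑ i ∈ Finset.range (p.natDegree + 1), p.coeff i * ∑ l ∈ Finset.range i, β ^ l * α ^ (i - 1 - l)) * (β - α) = 0 := by
      rw [Finset.sum_mul]
      simp only [mul_assoc, geom_sum₂_mul]
      simp only [mul_sub, Finset.sum_sub_distrib]
      rw [← Polynomial.eval_eq_sum_range, ← Polynomial.eval_eq_sum_range, hα, hβ, sub_self]
    exact (mul_eq_zero.1 this).resolve_right (sub_ne_zero.2 h)

lemma Expo.prime_const {n : ℕ} {P : Polynomial (MvPolynomial (Fin n) ℂ)} {u c h} (H : Expo (n := n) P u c h)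
    (D : MvPolynomial (Fin n) ℂ) (hD : D ≠ 0)
    (hs : ∀ x, MvPolynomial.eval x D ≠ 0 → ∀ t, ev2 x t P = 0 → ev2 x t P.derivative ≠ 0)
    (C : ℝ) (hC0 : 0 ≤ C) (hC : ∀ x t, ev2 x t P = 0 → ‖t‖ ≤ C * (1 + ‖x‖)) :
    ∃ D' : MvPolynomial (Fin n) ℂ, D' ≠ 0 ∧ ∀ Q : Polynomial (MvPolynomial (Fin n) ℂ), Prime Q → Q ∣ P →
      ∃ m : ℤ, ∀ x, MvPolynomial.eval x D' ≠ 0 → ∀ t, ev2 x t Q = 0 → c x t = m := by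
  obtain ⟨M, hM⟩ := H.M_const D hD hs
  choose S E hE hS using H.S_poly D hD hs C hC0 hC
  let d := P.natDegree
  let D' := D * ∏ j ∈ Finset.range (d + 1), E j
  have hD' : D' ≠ 0 := mul_ne_zero hD (Finset.prod_ne_zero_iff.2 fun j _ => hE j)
  have hD1 : ∀ x, MvPolynomial.eval x D' ≠ 0 → MvPolynomial.eval x D ≠ 0 := by
    intro x hx h0
    apply hx
    simp only [D', map_mul, h0, zero_mul]
  have hD2 : ∀ x, MvPolynomial.eval x D' ≠ 0 → ∀ j ∈ Finset.range (d + 1), MvPolynomial.eval x (E j) ≠ 0 := by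
    intro x hx j hj h0
    apply hx
    simp only [D', map_mul, map_prod]
    rw [Finset.prod_eq_zero hj h0, mul_zero]
  let N : Polynomial (MvPolynomial (Fin n) ℂ) := ∑ i ∈ Finset.range (d + 1), Polynomial.C (P.coeff i) *
    ∑ l ∈ Finset.range i, Polynomial.C (S l) * Polynomial.X ^ (i - 1 - l)
  have hN : ∀ x, MvPolynomial.eval x D' ≠ 0 → ∀ t, ev2 x t P = 0 →
      ev2 x t N = c x t * ev2 x t P.derivative := by
    intro x hx t ht
    have e1 : ev2 x t N = ∑ i ∈ Finset.range (d + 1), MvPolynomial.eval x (P.coeff i) *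
        ∑ l ∈ Finset.range i, (∑ β ∈ Rt P x, (c x β : ℂ) * β ^ l) * t ^ (i - 1 - l) := by
      simp only [N, map_sum, map_mul, map_pow]
      refine Finset.sum_congr rfl fun i hi => ?_
      congr 1
      · simp [ev2]
      · refine Finset.sum_congr rfl fun l hl => ?_
        rw [Finset.mem_range] at hi hl
        rw [hS l x (hD2 x hx l (Finset.mem_range.2 (by omega)))]
        simp [ev2]
    have e2 : ev2 x t N = ∑ β ∈ Rt P x, (c x β : ℂ) * ∑ i ∈ Finset.range (d + 1),
        MvPolynomial.eval x (P.coeff i) * ∑ l ∈ Finset.range i, β ^ l * t ^ (i - 1 - l) := by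
      rw [e1]
      simp only [Finset.mul_sum, Finset.sum_mul]
      rw [Finset.sum_comm (s := Rt P x)]
      refine Finset.sum_congr rfl fun i _ => ?_
      rw [Finset.sum_comm (s := Rt P x)]
      refine Finset.sum_congr rfl fun l _ => Finset.sum_congr rfl fun β _ => ?_
      ring
    rw [e2]
    have e3 : ∀ β ∈ Rt P x, (c x β : ℂ) * ∑ i ∈ Finset.range (d + 1),
        MvPolynomial.eval x (P.coeff i) * ∑ l ∈ Finset.range i, β ^ l * t ^ (i - 1 - l) =
        if β = t then (c x t : ℂ) * ev2 x t P.derivative else 0 := by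
      intro β hβ
      rw [mem_Rt H.mon, ev2_eq] at hβ
      rw [ev2_eq] at ht
      have := lagr (P.map (MvPolynomial.eval x)) β t hβ ht
      rw [H.mon.natDegree_map] at this
      simp only [Polynomial.coeff_map] at this
      rw [this, Polynomial.derivative_map, ← ev2_eq]
      split_ifs with hbt
      · rw [hbt]
      · simp
    rw [Finset.sum_congr rfl e3, Finset.sum_ite_eq' , if_pos ((mem_Rt H.mon _ _).2 ht)]
  have hdvd : P ∣ ∏ m ∈ M, (N - Polynomial.C (MvPolynomial.C (m : ℂ)) * P.derivative) := by
    refine dvd_of_vanish H.mon D' hD' (fun x hx => hs x (hD1 x hx)) _ ?_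
    intro x hx t ht
    rw [map_prod]
    have hm : c x t ∈ M := by
      rw [← hM x (hD1 x hx)]
      exact Finset.mem_image_of_mem _ ((mem_Rt H.mon _ _).2 ht)
    apply Finset.prod_eq_zero hm
    rw [map_sub, map_mul, hN x hx t ht]
    simp [ev2]
  refine ⟨D', hD', fun Q hQ hQP => ?_⟩
  obtain ⟨m, hm, hdv⟩ := (hQ.dvd_finsetProd_iff _).1 (hQP.trans hdvd)
  refine ⟨m, fun x hx t ht => ?_⟩
  have htP : ev2 x t P = 0 := by
    obtain ⟨K, hK⟩ := hQP
    rw [hK, map_mul, ht, zero_mul]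
  have h1 : ev2 x t (N - Polynomial.C (MvPolynomial.C (m : ℂ)) * P.derivative) = 0 := by
    obtain ⟨K, hK⟩ := hdv
    rw [hK, map_mul, ht, zero_mul]
  rw [map_sub, map_mul, hN x hx t htP] at h1
  have h2 : ev2 x t (Polynomial.C (MvPolynomial.C (m : ℂ))) = m := by simp [ev2]
  rw [h2, ← sub_mul] at h1
  have h3 := (mul_eq_zero.1 h1).resolve_right (hs x (hD1 x hx) t htP)
  exact_mod_cast sub_eq_zero.1 h3

lemma dense_ne {n : ℕ} (D : MvPolynomial (Fin n) ℂ) (hD : D ≠ 0) (x₀ : Fin n → ℂ)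
    (p : (Fin n → ℂ) → Prop) (hp : ∀ᶠ x in 𝓝 x₀, p x) : ∃ x, p x ∧ MvPolynomial.eval x D ≠ 0 := by
  obtain ⟨x₁, hx₁⟩ := exists_eval_ne D hD
  let w := x₁ - x₀
  have hfin := line_fin x₀ w D 1 (by simpa [w] using hx₁)
  have hct : ContinuousAt (fun s : ℂ => x₀ + s • w) 0 := by fun_prop
  have h1 : {s : ℂ | p (x₀ + s • w)} ∈ 𝓝 (0 : ℂ) := by
    apply hct.eventually
    simpa using hp
  obtain ⟨s, hs, hs2⟩ := ((infinite_of_mem_nhds _ h1).sdiff hfin).nonempty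
  exact ⟨_, hs, hs2⟩

lemma eval_prod_Rt (q : Polynomial ℂ) (F : Finset ℂ) (hF : ∀ a, q.eval a = 0 → a ∈ F) (hq : q ≠ 0) (t : ℂ) :
    q.eval t = q.leadingCoeff * ∏ α ∈ F, (t - α) ^ q.rootMultiplicity α := by
  classical
  conv_lhs => rw [(IsAlgClosed.splits q).eq_prod_roots]
  rw [Polynomial.eval_mul, Polynomial.eval_C, Polynomial.eval_multiset_prod, Multiset.map_map]
  congr 1
  have : (fun x : ℂ => Polynomial.eval t (Polynomial.X - Polynomial.C x)) = fun x => t - x := by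
    ext x; simp
  rw [show (Polynomial.eval t ∘ fun a : ℂ => Polynomial.X - Polynomial.C a) = fun x => t - x from this]
  rw [Finset.prod_multiset_map_count]
  simp only [Polynomial.count_roots]
  apply Finset.prod_subset
  · intro a ha
    apply hF
    rw [Multiset.mem_toFinset, Polynomial.mem_roots hq] at ha
    exact ha
  · intro a _ ha
    rw [Polynomial.rootMultiplicity_eq_zero, pow_zero]
    intro h
    apply ha
    rw [Multiset.mem_toFinset, Polynomial.mem_roots hq]
    exact h

lemma prod_zpow_aux {ι : Type*} {a : ℂ} (ha : a ≠ 0) (s : Finset ι) (f : ι → ℤ) :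
    ∏ i ∈ s, a ^ f i = a ^ ∑ i ∈ s, f i := by
  classical
  induction s using Finset.induction_on with
  | empty => simp
  | insert i s hi ih => rw [Finset.prod_insert hi, Finset.sum_insert hi, zpow_add₀ ha, ih]

lemma gen {n : ℕ} {ι : Type*} [Fintype ι] (P W : Polynomial (MvPolynomial (Fin n) ℂ))
    (Q : ι → Polynomial (MvPolynomial (Fin n) ℂ)) (hP : P.Monic) (hsf : Squarefree P)
    (hQ : ∀ j, Prime (Q j)) (hW : IsUnit W) (hPQ : P = W * ∏ j, Q j)
    (C : ℝ) (hC0 : 0 ≤ C) (hC : ∀ x t, ev2 x t P = 0 → ‖t‖ ≤ C * (1 + ‖x‖))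
    (u : (Fin n → ℂ) × ℂ → ℂ)
    (hu : ContinuousOn u {p : (Fin n → ℂ) × ℂ | ev2 p.1 p.2 P ≠ 0})
    (h0 : ∀ p : (Fin n → ℂ) × ℂ, ev2 p.1 p.2 P ≠ 0 → u p ≠ 0) :
    ∃ (m : ι → ℤ) (k : (Fin n → ℂ) × ℂ → ℂ),
      ContinuousOn k {p : (Fin n → ℂ) × ℂ | ev2 p.1 p.2 P ≠ 0} ∧
      ∀ p : (Fin n → ℂ) × ℂ, ev2 p.1 p.2 P ≠ 0 →
        u p = Complex.exp (k p) * ∏ j, ev2 p.1 p.2 (Q j) ^ m j := by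
  classical
  obtain ⟨A, B, D, hD, hABD⟩ := disc_exists P hP hsf
  have hs : ∀ x, MvPolynomial.eval x D ≠ 0 → ∀ t, ev2 x t P = 0 → ev2 x t P.derivative ≠ 0 := by
    intro x hx t ht ht2
    apply hx
    have := congrArg (ev2 x t) hABD
    rw [map_add, map_mul, map_mul, ht, ht2] at this
    simpa [ev2] using this.symm
  obtain ⟨c, h, H⟩ := exists_expo P hP u hu h0
  obtain ⟨D', hD', hconst⟩ := H.prime_const D hD hs C hC0 hC
  have hdv : ∀ j, Q j ∣ P := fun j => by
    rw [hPQ]; exact (Finset.dvd_prod_of_mem Q (Finset.mem_univ j)).mul_left W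
  choose m hm using fun j => hconst (Q j) (hQ j) (hdv j)
  have hQP : ∀ j x t, ev2 x t P ≠ 0 → ev2 x t (Q j) ≠ 0 := by
    intro j x t hp hq
    apply hp
    obtain ⟨K, hK⟩ := hdv j
    rw [hK, map_mul, hq, zero_mul]
  let Y : (Fin n → ℂ) × ℂ → ℂ := fun p => ∏ j, ev2 p.1 p.2 (Q j) ^ m j
  have hY0 : ∀ p : (Fin n → ℂ) × ℂ, ev2 p.1 p.2 P ≠ 0 → Y p ≠ 0 := fun p hp =>
    Finset.prod_ne_zero_iff.2 fun j _ => zpow_ne_zero _ (hQP j _ _ hp)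
  have hYc : ContinuousOn Y {p : (Fin n → ℂ) × ℂ | ev2 p.1 p.2 P ≠ 0} := by
    refine continuousOn_finsetProd _ fun j _ => ?_
    exact (ev2_cont (Q j)).continuousOn.zpow₀ _ fun p hp => Or.inl (hQP j _ _ hp)
  let U : (Fin n → ℂ) × ℂ → ℂ := fun p => u p / Y p
  have hUc : ContinuousOn U {p : (Fin n → ℂ) × ℂ | ev2 p.1 p.2 P ≠ 0} := hu.div hYc hY0
  have hU0 : ∀ p : (Fin n → ℂ) × ℂ, ev2 p.1 p.2 P ≠ 0 → U p ≠ 0 := fun p hp =>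
    div_ne_zero (h0 p hp) (hY0 p hp)
  obtain ⟨c', h', H'⟩ := exists_expo P hP U hUc hU0
  have hE : D * D' ≠ 0 := mul_ne_zero hD hD'
  have hgen : ∀ x, MvPolynomial.eval x (D * D') ≠ 0 → ∃ k : ℂ → ℂ, ContinuousOn k (Rt P x : Set ℂ)ᶜ ∧
      ∀ t ∉ Rt P x, U (x, t) = Complex.exp (k t) := by
    intro x hx
    rw [map_mul] at hx
    have hx1 := left_ne_zero_of_mul hx
    have hx2 := right_ne_zero_of_mul hx
    let q : ι → Polynomial ℂ := fun j => (Q j).map (MvPolynomial.eval x)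
    have hPx : P.map (MvPolynomial.eval x) = W.map (MvPolynomial.eval x) * ∏ j, q j := by
      simp only [q]
      rw [← Polynomial.map_prod, ← Polynomial.map_mul, ← hPQ]
    have hPx0 := (hP.map (MvPolynomial.eval x)).ne_zero
    have hq0 : ∀ j, q j ≠ 0 := by
      intro j hj
      apply hPx0
      rw [hPx, Finset.prod_eq_zero (Finset.mem_univ j) hj, mul_zero]
    have hsum : ∀ α ∈ Rt P x, ∑ j, (q j).rootMultiplicity α = 1 := by
      intro α hα
      have h1 : (P.map (MvPolynomial.eval x)).rootMultiplicity α = 1 := by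
        rw [← Polynomial.count_roots]
        rw [Rt, Multiset.mem_toFinset] at hα
        exact Multiset.count_eq_one_of_mem (card_Rt hP x (hs x hx1)).2 hα
      have hWu : IsUnit (W.map (MvPolynomial.eval x)) := hW.map (Polynomial.mapRingHom _)
      rw [hPx, Polynomial.rootMultiplicity_mul (by rw [← hPx]; exact hPx0)] at h1
      have hw : (W.map (MvPolynomial.eval x)).rootMultiplicity α = 0 := by
        rw [Polynomial.rootMultiplicity_eq_zero]
        intro hr
        have := hWu.map (Polynomial.evalRingHom α)
        rw [Polynomial.coe_evalRingHom, hr] at this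
        exact not_isUnit_zero this
      rw [hw, zero_add, ← Polynomial.count_roots, Polynomial.roots_prod _ _
        (Finset.prod_ne_zero_iff.2 fun j _ => hq0 j)] at h1
      rw [← h1, Multiset.count_bind]
      simp only [Polynomial.count_roots]
      rfl
    have hexp : ∀ α ∈ Rt P x, ∑ j, m j * ((q j).rootMultiplicity α : ℤ) = c x α := by
      intro α hα
      have : ∀ j, m j * ((q j).rootMultiplicity α : ℤ) = c x α * ((q j).rootMultiplicity α : ℤ) := by
        intro j
        by_cases hr : (q j).eval α = 0
        · rw [hm j x hx2 α (by rw [ev2_eq]; exact hr)]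
        · rw [Polynomial.rootMultiplicity_eq_zero hr]; simp
      rw [Finset.sum_congr rfl fun j _ => this j, ← Finset.mul_sum, ← Nat.cast_sum, hsum α hα]
      simp
    let l : ℂ := ∏ j, (q j).leadingCoeff ^ m j
    have hl : l ≠ 0 := Finset.prod_ne_zero_iff.2 fun j _ =>
      zpow_ne_zero _ (Polynomial.leadingCoeff_ne_zero.2 (hq0 j))
    refine ⟨fun t => h x t - Complex.log l, (H.hc x).sub continuousOn_const, fun t ht => ?_⟩
    have htP : ev2 x t P ≠ 0 := fun h => ht ((mem_Rt hP _ _).2 h)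
    have hY : Y (x, t) = l * ∏ α ∈ Rt P x, (t - α) ^ c x α := by
      simp only [Y, l]
      have : ∀ j, ev2 x t (Q j) ^ m j = (q j).leadingCoeff ^ m j *
          ∏ α ∈ Rt P x, (t - α) ^ (m j * ((q j).rootMultiplicity α : ℤ)) := by
        intro j
        rw [ev2_eq, eval_prod_Rt (q j) (Rt P x) _ (hq0 j), mul_zpow, ← Finset.prod_zpow]
        · congr 1
          refine Finset.prod_congr rfl fun α _ => ?_
          rw [mul_comm, zpow_mul, zpow_natCast]
        · intro a ha
          rw [mem_Rt hP]
          obtain ⟨K, hK⟩ := hdv j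
          rw [hK, map_mul, ev2_eq x a (Q j), ha, zero_mul]
      rw [Finset.prod_congr rfl fun j _ => this j, Finset.prod_mul_distrib, Finset.prod_comm]
      congr 1
      refine Finset.prod_congr rfl fun α hα => ?_
      rw [← hexp α hα]
      have hne : t - α ≠ 0 := by
        intro h
        rw [sub_eq_zero] at h
        exact ht (h ▸ hα)
      exact prod_zpow_aux hne _ _
    have hne : ∏ α ∈ Rt P x, (t - α) ^ c x α ≠ 0 := by
      have := hY0 (x, t) htP
      rw [hY] at this
      exact right_ne_zero_of_mul this
    simp only [U]
    rw [hY, H.he x t ht, Complex.exp_sub, Complex.exp_log hl]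
    field_simp
  have hzero : ∀ x, ∀ β ∈ Rt P x, c' x β = 0 := by
    intro x₀ β hβ
    obtain ⟨r, hr, hsep⟩ := sep_radius (Rt P x₀)
    have hcirc : ∀ z : Circle, ev2 x₀ (β + r * (z : ℂ)) P ≠ 0 := by
      intro z hz
      have hn : ‖(β + r * (z : ℂ)) - β‖ = r := by
        rw [add_sub_cancel_left, norm_mul, Circle.norm_coe, Complex.norm_real, Real.norm_of_nonneg hr.le, mul_one]
      have := hsep β hβ _ ((mem_Rt hP _ _).2 hz) (by rw [hn]; linarith)
      rw [this, sub_self, norm_zero] at hn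
      exact hr.ne hn
    have hdeg := H'.deg x₀ β r hr hcirc
    have hsum : ∑ γ ∈ Rt P x₀ with ‖γ - β‖ < r, c' x₀ γ = c' x₀ β := by
      have : (Rt P x₀).filter (fun γ => ‖γ - β‖ < r) = {β} := by
        ext γ
        simp only [Finset.mem_filter, Finset.mem_singleton]
        constructor
        · rintro ⟨hb, hb2⟩
          exact hsep β hβ γ hb (by linarith)
        · rintro rfl
          simpa using ⟨hβ, hr⟩
      rw [this, Finset.sum_singleton]
    rw [hsum] at hdeg
    obtain ⟨x, ⟨hx1, hx2⟩, hx3⟩ := dense_ne _ hE x₀ _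
      (circ_stable _ (Om_open P) U hUc hU0 x₀ β r _ hcirc hdeg)
    obtain ⟨k, hk, hk1⟩ := hgen x hx3
    have hmem : ∀ z : Circle, β + r * (z : ℂ) ∉ Rt P x := fun z hz => hx1 z ((mem_Rt hP _ _).1 hz)
    have h3 : HasDeg (fun z : Circle => U (x, β + r * (z : ℂ))) 0 := by
      have : (fun z : Circle => U (x, β + r * (z : ℂ))) = fun z : Circle => Complex.exp (k (β + r * (z : ℂ))) :=
        funext fun z => hk1 _ (hmem z)
      rw [this]
      exact HasDeg.exp (hk.comp_continuous (by fun_prop) hmem)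
    exact hx2.unique h3
  have hCn : ∀ x : Fin n → ℂ, 0 ≤ C * (1 + ‖x‖) := fun x => by positivity
  obtain ⟨k, hk, hk1⟩ := glue_log {p : (Fin n → ℂ) × ℂ | ev2 p.1 p.2 P ≠ 0} (Om_open P) (Rt P)
    (fun x t => (not_congr (mem_Rt hP x t)).symm) U hUc hU0
    (fun x => ((C * (1 + ‖x‖) + 1 : ℝ) : ℂ)) (by fun_prop) (by
      intro x hx
      have := hC x _ hx
      rw [Complex.norm_real, Real.norm_of_nonneg (by linarith [hCn x])] at this
      linarith) (by
      intro x
      refine ⟨h' x, H'.hc x, fun t ht => ?_⟩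
      rw [H'.he x t ht, Finset.prod_eq_one, mul_one]
      intro β hβ
      rw [hzero x β hβ, zpow_zero])
  refine ⟨m, k, hk, fun p hp => ?_⟩
  rw [← hk1 p hp]
  exact (div_mul_cancel₀ _ (hY0 p hp)).symm

lemma eval_smul_hom {n : ℕ} (g : MvPolynomial (Fin n) ℂ) (d : ℕ) (hg : g.IsHomogeneous d) (t : ℂ)
    (x : Fin n → ℂ) : MvPolynomial.eval (t • x) g = t ^ d * MvPolynomial.eval x g := by
  rw [← ev2_tau, tau_hom g d hg]
  simp [ev2]
  ring

lemma genG {n : ℕ} {ι : Type*} [Fintype ι] (g w : MvPolynomial (Fin n) ℂ)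
    (q : ι → MvPolynomial (Fin n) ℂ) (d : ℕ) (hd : 0 < d) (hg : g.IsHomogeneous d)
    (hsf : Squarefree g) (hq : ∀ j, Irreducible (q j)) (hw : IsUnit w) (hgq : g = w * ∏ j, q j)
    (u : (Fin n → ℂ) → ℂ) (hu : ContinuousOn u {x | MvPolynomial.eval x g ≠ 0})
    (h0 : ∀ x, MvPolynomial.eval x g ≠ 0 → u x ≠ 0) :
    ∃ (m : ι → ℤ) (k : (Fin n → ℂ) → ℂ), ContinuousOn k {x | MvPolynomial.eval x g ≠ 0} ∧
      ∀ x, MvPolynomial.eval x g ≠ 0 →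
        u x = Complex.exp (k x) * ∏ j, MvPolynomial.eval x (q j) ^ m j := by
  have hg0 : g ≠ 0 := hsf.ne_zero
  obtain ⟨v, hv⟩ : ∃ v, MvPolynomial.eval v g = 1 := by
    obtain ⟨v₀, hv₀⟩ := exists_eval_ne g hg0
    obtain ⟨t, ht⟩ := IsAlgClosed.exists_pow_nat_eq (MvPolynomial.eval v₀ g)⁻¹ hd
    exact ⟨t • v₀, by rw [eval_smul_hom g d hg, ht, inv_mul_cancel₀ hv₀]⟩
  obtain ⟨hmon, -⟩ := sh_monic v g d hg hv
  obtain ⟨κ, hκ, hκ2⟩ : ∃ κ : ℝ, 0 < κ ∧ ∀ y, ‖y‖ < κ → MvPolynomial.eval (v + y) g ≠ 0 := by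
    have hc : ContinuousAt (fun y => MvPolynomial.eval (v + y) g) 0 :=
      ((MvPolynomial.continuous_eval g).comp (by fun_prop : Continuous fun y => v + y)).continuousAt
    have := hc.eventually_ne (y := 0) (by simp [hv])
    obtain ⟨κ, hκ, h⟩ := Metric.eventually_nhds_iff.1 this
    exact ⟨κ, hκ, fun y hy => h (by simpa using hy)⟩
  have hC : ∀ x t, ev2 x t (sh v g) = 0 → ‖t‖ ≤ κ⁻¹ * (1 + ‖x‖) := by
    intro x t ht
    by_cases ht0 : t = 0
    · rw [ht0, norm_zero]; positivity
    have h1 : MvPolynomial.eval (v + t⁻¹ • x) g = 0 := by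
      have : x + t • v = t • (v + t⁻¹ • x) := by
        rw [smul_add, smul_smul, mul_inv_cancel₀ ht0, one_smul, add_comm]
      rw [ev2_sh, this, eval_smul_hom g d hg] at ht
      exact (mul_eq_zero.1 ht).resolve_left (pow_ne_zero _ ht0)
    have h2 : κ ≤ ‖t⁻¹ • x‖ := by
      by_contra h
      exact hκ2 _ (not_le.1 h) h1
    rw [norm_smul, norm_inv] at h2
    have ht1 : 0 < ‖t‖ := norm_pos_iff.2 ht0
    rw [inv_mul_eq_div, le_div_iff₀ ht1] at h2
    rw [inv_mul_eq_div, le_div_iff₀ hκ]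
    nlinarith
  have hcs : Continuous (fun p : (Fin n → ℂ) × ℂ => p.1 + p.2 • v) := by fun_prop
  obtain ⟨m, k, hk, hk1⟩ := gen (sh v g) (sh v w) (fun j => sh v (q j)) hmon (sh_squarefree v g hsf hg0)
    (fun j => sh_prime v _ (hq j)) (hw.map _) (by rw [hgq, map_mul, map_prod]) κ⁻¹ (by positivity) hC
    (fun p => u (p.1 + p.2 • v))
    (hu.comp hcs.continuousOn (fun p hp => by
      simpa [ev2_sh] using hp))
    (fun p hp => h0 _ (by simpa [ev2_sh] using hp))
  refine ⟨m, fun x => k (x, 0), ?_, fun x hx => ?_⟩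
  · refine hk.comp (by fun_prop) fun x hx => ?_
    simpa [ev2_sh] using hx
  · have := hk1 (x, 0) (by simpa [ev2_sh] using hx)
    simpa [ev2_sh] using this

lemma deg_poly (q : Polynomial ℂ) (hq : q ≠ 0) (r : ℝ) (hr : 0 < r)
    (h : ∀ s : ℂ, ‖s‖ ≤ r → q.eval s = 0 → s = 0) :
    HasDeg (fun z : Circle => q.eval (r * (z : ℂ))) (q.rootMultiplicity 0) := by
  classical
  let F : Finset ℂ := insert 0 q.roots.toFinset
  have hF : ∀ a, q.eval a = 0 → a ∈ F := by
    intro a ha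
    simp [F, hq, ha]
  have hF2 : ∀ a ∈ F, a = 0 ∨ q.eval a = 0 := by
    intro a ha
    simpa [F, hq] using ha
  have hl : q.leadingCoeff ≠ 0 := Polynomial.leadingCoeff_ne_zero.2 hq
  have hnr : ∀ β ∈ F, ‖β‖ ≤ r → β = 0 := by
    intro β hβ hb
    rcases hF2 β hβ with h1 | h1
    · exact h1
    · exact h β hb h1
  have := fibre_deg F (fun t => q.eval t) (fun _ => Complex.log q.leadingCoeff)
    (fun α => (q.rootMultiplicity α : ℤ)) continuousOn_const (by
      intro t _
      rw [Complex.exp_log hl, eval_prod_Rt q F hF hq]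
      simp) 0 r hr (by
      intro β hβ hb
      rw [sub_zero] at hb
      have := hnr β hβ hb.le
      rw [this, norm_zero] at hb
      exact hr.ne hb)
  have hs : F.filter (fun β => ‖β - 0‖ < r) = {0} := by
    ext β
    simp only [Finset.mem_filter, Finset.mem_singleton, sub_zero]
    constructor
    · rintro ⟨h1, h2⟩
      exact hnr β h1 h2.le
    · rintro rfl
      simp [F, hr]
  rw [hs, Finset.sum_singleton] at this
  simpa using this

lemma indep {n : ℕ} {ι : Type*} [Fintype ι] (f w : MvPolynomial (Fin n) ℂ)
    (p : ι → MvPolynomial (Fin n) ℂ) (d : ℕ) (hf : f.IsHomogeneous d)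
    (hsf : Squarefree f) (hp : ∀ j, Irreducible (p j)) (hw : IsUnit w) (hfp : f = w * ∏ j, p j)
    (W : Set (Fin n → ℂ)) (hW : IsOpen W) (hW0 : 0 ∈ W) (a : ι → ℤ) (h : (Fin n → ℂ) → ℂ)
    (hh : ContinuousOn h (W ∩ {x | MvPolynomial.eval x f ≠ 0}))
    (he : ∀ x ∈ W, MvPolynomial.eval x f ≠ 0 →
      ∏ j, MvPolynomial.eval x (p j) ^ a j = Complex.exp (h x)) (i : ι) : a i = 0 := by
  classical
  have hf0 : f ≠ 0 := hsf.ne_zero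
  let r := ∏ j ∈ Finset.univ.erase i, p j
  have hfr : f = w * (p i * r) := by
    rw [hfp, Finset.mul_prod_erase _ _ (Finset.mem_univ i)]
  have hpr : ¬ p i ∣ r := by
    intro hdv
    have : p i * p i ∣ f := by
      rw [hfr]
      exact (mul_dvd_mul_left _ hdv).mul_left _
    exact (hp i).not_isUnit (hsf _ this)
  obtain ⟨x, hx, hxr⟩ : ∃ x, MvPolynomial.eval x (p i) = 0 ∧ MvPolynomial.eval x r ≠ 0 := by
    by_contra hcon
    push Not at hcon
    apply hpr
    have hprime : (Ideal.span {p i}).IsPrime :=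
      (Ideal.span_singleton_prime (hp i).ne_zero).2 (hp i).prime
    have h1 := MvPolynomial.vanishingIdeal_zeroLocus_eq_radical (K := ℂ) (Ideal.span {p i})
    rw [hprime.radical] at h1
    rw [← Ideal.mem_span_singleton, ← h1, MvPolynomial.mem_vanishingIdeal_iff]
    intro x hx
    rw [MvPolynomial.mem_zeroLocus_iff] at hx
    have := hx (p i) (Ideal.mem_span_singleton_self _)
    exact hcon x this
  have hpf : ∀ j, p j ∣ f := fun j => by
    rw [hfp]; exact (Finset.dvd_prod_of_mem p (Finset.mem_univ j)).mul_left w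
  obtain ⟨x, hx, hxr, hxW⟩ : ∃ x, MvPolynomial.eval x (p i) = 0 ∧ MvPolynomial.eval x r ≠ 0 ∧ x ∈ W := by
    obtain ⟨a1, ha1⟩ := factor_hom f (p i) d hf hf0 (hpf i)
    obtain ⟨a2, ha2⟩ := factor_hom f r d hf hf0 (by rw [hfr]; exact (dvd_mul_left _ _).mul_left _)
    have hct : ContinuousAt (fun t : ℂ => t • x) 0 := by fun_prop
    have h1 : ∀ᶠ t : ℂ in 𝓝[≠] 0, t • x ∈ W :=
      nhdsWithin_le_nhds (hct.eventually (hW.mem_nhds (by simpa using hW0)))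
    obtain ⟨t, ht, ht0⟩ := (h1.and self_mem_nhdsWithin).exists
    refine ⟨t • x, ?_, ?_, ht⟩
    · rw [ha1, hx, mul_zero]
    · rw [ha2]; exact mul_ne_zero (pow_ne_zero _ ht0) hxr
  have hxj : ∀ j, j ≠ i → MvPolynomial.eval x (p j) ≠ 0 := by
    intro j hj h0
    apply hxr
    simp only [r, map_prod]
    exact Finset.prod_eq_zero (Finset.mem_erase.2 ⟨hj, Finset.mem_univ _⟩) h0
  obtain ⟨x₁, hx₁⟩ := exists_eval_ne (p i) (hp i).ne_zero
  let v := x₁ - x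
  let q : ι → Polynomial ℂ := fun j => (sh v (p j)).map (MvPolynomial.eval x)
  have hqe : ∀ j s, (q j).eval s = MvPolynomial.eval (x + s • v) (p j) := by
    intro j s
    simp only [q]
    rw [← ev2_eq, ev2_sh]
  have hq0 : ∀ j, q j ≠ 0 := by
    intro j hj
    by_cases hji : j = i
    · have := hqe j 1
      rw [hj, hji] at this
      simp [v] at this
      exact hx₁ this.symm
    · have := hqe j 0
      rw [hj] at this
      simp at this
      exact hxj j hji this.symm
  have hev : ∀ᶠ s : ℂ in 𝓝 0, x + s • v ∈ W ∧ ∀ j, (q j).eval s = 0 → s = 0 := by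
    have hct : ContinuousAt (fun t : ℂ => x + t • v) 0 := by fun_prop
    refine (hct.eventually (hW.mem_nhds (by simpa using hxW))).and ?_
    rw [Filter.eventually_all]
    intro j
    have hcl : IsClosed (((q j).roots.toFinset.erase 0 : Finset ℂ) : Set ℂ) :=
      (Finset.finite_toSet _).isClosed
    filter_upwards [hcl.isOpen_compl.mem_nhds (x := 0) (by simp)] with s hs hs0
    by_contra hne
    apply hs
    simp [hne, hq0 j, hs0]
  obtain ⟨ε, hε, hε2⟩ := Metric.eventually_nhds_iff.1 hev
  let ρ := ε / 2
  have hρ : 0 < ρ := by positivity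
  have hlt : ∀ s : ℂ, ‖s‖ ≤ ρ → dist s 0 < ε := by
    intro s hs
    rw [dist_zero_right]
    simp only [ρ] at hs
    linarith
  have hdegs : ∀ j, HasDeg (fun z : Circle => (q j).eval (ρ * (z : ℂ))) ((q j).rootMultiplicity 0) :=
    fun j => deg_poly (q j) (hq0 j) ρ hρ fun s hs hs0 => (hε2 (hlt s hs)).2 j hs0
  have hnz : ∀ z : Circle, ‖(ρ : ℂ) * (z : ℂ)‖ = ρ := by
    intro z
    rw [norm_mul, Circle.norm_coe, Complex.norm_real, Real.norm_of_nonneg hρ.le, mul_one]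
  have hcW : ∀ z : Circle, x + ((ρ : ℂ) * (z : ℂ)) • v ∈ W ∩ {x | MvPolynomial.eval x f ≠ 0} := by
    intro z
    have h1 := hε2 (hlt _ (hnz z).le)
    refine ⟨h1.1, ?_⟩
    simp only [Set.mem_ofPred_eq]
    rw [hfp, map_mul, map_prod]
    refine mul_ne_zero (hw.map _).ne_zero (Finset.prod_ne_zero_iff.2 fun j _ => ?_)
    rw [← hqe]
    intro h0
    have := h1.2 j h0
    have h2 := hnz z
    rw [this, norm_zero] at h2
    exact hρ.ne h2
  have hd1 := HasDeg.prod Finset.univ (fun j (z : Circle) => (q j).eval (ρ * (z : ℂ)) ^ a j) _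
    (fun j _ => (hdegs j).zpow (a j))
  have hd2 : HasDeg (fun z : Circle => ∏ j, (q j).eval (ρ * (z : ℂ)) ^ a j) 0 := by
    have : (fun z : Circle => ∏ j, (q j).eval (ρ * (z : ℂ)) ^ a j) =
        fun z : Circle => Complex.exp (h (x + ((ρ : ℂ) * (z : ℂ)) • v)) := by
      funext z
      rw [← he _ (hcW z).1 (hcW z).2]
      simp only [hqe]
    rw [this]
    exact HasDeg.exp (hh.comp_continuous (by fun_prop) hcW)
  have hfin := hd1.unique hd2
  rw [Finset.sum_eq_single i] at hfin
  · rcases mul_eq_zero.1 hfin with h1 | h1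
    · exact h1
    · exfalso
      have h2 : (q i).rootMultiplicity 0 = 0 := by exact_mod_cast h1
      rw [Polynomial.rootMultiplicity_eq_zero_iff] at h2
      refine hq0 i (h2 ?_)
      rw [Polynomial.IsRoot, hqe]
      simpa using hx
  · intro j _ hj
    rw [Polynomial.rootMultiplicity_eq_zero]
    · simp
    · rw [Polynomial.IsRoot, hqe]
      simpa using hxj j hj
  · intro h; exact absurd (Finset.mem_univ i) h

lemma facs {n : ℕ} (f : MvPolynomial (Fin n) ℂ) (hf : f ≠ 0) :
    ∃ (w : MvPolynomial (Fin n) ℂ)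
      (p : Fin (UniqueFactorizationMonoid.factors f).card → MvPolynomial (Fin n) ℂ),
      IsUnit w ∧ (∀ j, Irreducible (p j)) ∧ f = w * ∏ j, p j := by
  set M := UniqueFactorizationMonoid.factors f with hM
  have hl : M.toList.length = M.card := Multiset.length_toList M
  obtain ⟨u, hu⟩ := UniqueFactorizationMonoid.factors_prod hf
  refine ⟨u, fun j => M.toList.get (j.cast hl.symm), u.isUnit, ?_, ?_⟩
  · intro j
    apply UniqueFactorizationMonoid.irreducible_of_factor (a := f)
    exact Multiset.mem_toList.1 (List.get_mem _ _)
  · have h1 : ∏ j : Fin M.card, M.toList.get (j.cast hl.symm) = M.prod := by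
      rw [← Multiset.prod_toList, ← List.prod_ofFn]
      congr 1
      rw [List.ofFn_congr hl.symm]
      exact List.ofFn_get _
    rw [h1, mul_comm]
    exact hu.symm

lemma eval_fac_ne {n : ℕ} {ι : Type*} [Fintype ι] (f w : MvPolynomial (Fin n) ℂ)
    (p : ι → MvPolynomial (Fin n) ℂ) (hfp : f = w * ∏ j, p j) (x : Fin n → ℂ)
    (hx : MvPolynomial.eval x f ≠ 0) (i : ι) : MvPolynomial.eval x (p i) ≠ 0 := by
  intro h
  apply hx
  rw [hfp, map_mul, map_prod, Finset.prod_eq_zero (Finset.mem_univ i) h, mul_zero]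

lemma card_le_aux (n : ℕ) (f g : MvPolynomial (Fin n) ℂ)
    (hgdeg : 0 < g.totalDegree)
    (hfsf : Squarefree f) (hgsf : Squarefree g)
    (hfhom : f.IsHomogeneous f.totalDegree) (hghom : g.IsHomogeneous g.totalDegree)
    (hφ : BiLipGermHomeo (pV f) (pV g)) :
    (UniqueFactorizationMonoid.factors f).card ≤
      (UniqueFactorizationMonoid.factors g).card := by
  classical
  obtain ⟨U, U', φ, ψ, K, hU, hU', h0U, h0U', hφ0, hm, hm', hl, hr, hL, hL', him⟩ := hφ
  obtain ⟨w, p, hw, hp, hfp⟩ := facs f hfsf.ne_zero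
  obtain ⟨w', q, hw', hq, hgq⟩ := facs g hgsf.ne_zero
  obtain ⟨δ, hδ, hB⟩ := Metric.isOpen_iff.1 hU' 0 h0U'
  have hfg : ∀ x ∈ U, MvPolynomial.eval (x : Fin n → ℂ) f ≠ 0 →
      MvPolynomial.eval (φ x : Fin n → ℂ) g ≠ 0 := by
    intro x hx h1 h2
    have : φ x ∈ pV g ∩ U' := ⟨h2, hm hx⟩
    rw [← him] at this
    obtain ⟨z, ⟨hz1, hz2⟩, hz3⟩ := this
    have : z = x := by rw [← hl hz2, hz3, hl hx]
    subst this
    exact h1 hz1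
  have hgf : ∀ y ∈ U', MvPolynomial.eval (y : Fin n → ℂ) g ≠ 0 →
      MvPolynomial.eval (ψ y : Fin n → ℂ) f ≠ 0 := by
    intro y hy h1 h2
    have : φ (ψ y) ∈ φ '' (pV f ∩ U) := ⟨ψ y, ⟨h2, hm' hy⟩, rfl⟩
    rw [him, hr hy] at this
    exact h1 this.1
  let ρ : En n → ℂ := fun y => ((δ / (1 + ‖y‖) : ℝ) : ℂ)
  have hρ : Continuous ρ := by
    apply Complex.continuous_ofReal.comp
    apply continuous_const.div (by fun_prop)
    intro y
    positivity
  have hρ0 : ∀ y, ρ y ≠ 0 := by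
    intro y
    apply Complex.ofReal_ne_zero.2
    positivity
  have hρB : ∀ y, ρ y • y ∈ U' := by
    intro y
    apply hB
    rw [mem_ball_zero_iff, norm_smul, Complex.norm_real, Real.norm_eq_abs, abs_of_pos (by positivity),
      div_mul_eq_mul_div, div_lt_iff₀ (by positivity)]
    nlinarith [norm_nonneg y]
  let T : (Fin n → ℂ) → En n := fun y => WithLp.toLp 2 y
  have hT : Continuous T := PiLp.continuous_toLp 2 _
  have hTo : Continuous (fun x : En n => (x : Fin n → ℂ)) := PiLp.continuous_ofLp 2 _
  let u : Fin (UniqueFactorizationMonoid.factors f).card → (Fin n → ℂ) → ℂ :=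
    fun i y => MvPolynomial.eval (ψ (ρ (T y) • T y) : Fin n → ℂ) (p i)
  have hgρ : ∀ y : Fin n → ℂ, MvPolynomial.eval y g ≠ 0 →
      MvPolynomial.eval (ρ (T y) • T y : En n).ofLp g ≠ 0 := by
    intro y hy
    rw [WithLp.ofLp_smul, eval_smul_hom g _ hghom]
    exact mul_ne_zero (pow_ne_zero _ (hρ0 _)) hy
  have hgen : ∀ i, ∃ (m : Fin (UniqueFactorizationMonoid.factors g).card → ℤ) (k : (Fin n → ℂ) → ℂ),
      ContinuousOn k {x | MvPolynomial.eval x g ≠ 0} ∧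
      ∀ x, MvPolynomial.eval x g ≠ 0 →
        u i x = Complex.exp (k x) * ∏ j, MvPolynomial.eval x (q j) ^ m j := by
    intro i
    apply genG g w' q _ hgdeg hghom hgsf hq hw' hgq
    · have h1 : ContinuousOn (fun y : Fin n → ℂ => ψ (ρ (T y) • T y)) {x | MvPolynomial.eval x g ≠ 0} :=
        hL'.continuousOn.comp ((hρ.comp hT).smul hT).continuousOn (fun y _ => hρB _)
      exact (MvPolynomial.continuous_eval (p i)).comp_continuousOn (hTo.comp_continuousOn h1)
    · intro y hy
      exact eval_fac_ne f w p hfp _ (hgf _ (hρB _) (hgρ y hy)) i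
  choose m k hk hu using hgen
  let A : (Fin (UniqueFactorizationMonoid.factors f).card → ℤ) →ₗ[ℤ]
      (Fin (UniqueFactorizationMonoid.factors g).card → ℤ) :=
    { toFun := fun a j => ∑ i, a i * m i j
      map_add' := by
        intro a b
        ext j
        simp [add_mul, Finset.sum_add_distrib]
      map_smul' := by
        intro c a
        ext j
        simp [mul_assoc, Finset.mul_sum] }
  apply le_of_fin_injective ℤ A
  rw [← LinearMap.ker_eq_bot, LinearMap.ker_eq_bot']
  intro a ha
  have ha' : ∀ j, ∑ i, a i * m i j = 0 := fun j => congrFun ha j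
  have hexp : ∀ y, MvPolynomial.eval y g ≠ 0 →
      ∏ i, u i y ^ a i = Complex.exp (∑ i, a i * k i y) := by
    intro y hy
    have h1 : ∀ i, u i y ^ a i = Complex.exp (a i * k i y) *
        ∏ j, MvPolynomial.eval y (q j) ^ (a i * m i j) := by
      intro i
      rw [hu i y hy, mul_zpow, ← Complex.exp_int_mul, ← Finset.prod_zpow]
      congr 1
      apply Finset.prod_congr rfl
      intro j _
      rw [← zpow_mul, mul_comm]
    rw [Finset.prod_congr rfl (fun i _ => h1 i), Finset.prod_mul_distrib, ← Complex.exp_sum,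
      Finset.prod_comm]
    have h2 : ∀ j, ∏ i, MvPolynomial.eval y (q j) ^ (a i * m i j) = 1 := by
      intro j
      have hz : ∀ s : Finset (Fin (UniqueFactorizationMonoid.factors f).card),
          ∏ i ∈ s, MvPolynomial.eval y (q j) ^ (a i * m i j) =
            MvPolynomial.eval y (q j) ^ (∑ i ∈ s, a i * m i j) := by
        intro s
        induction s using Finset.induction_on with
        | empty => simp
        | insert b s hb ih =>
          rw [Finset.prod_insert hb, Finset.sum_insert hb, ih,
            zpow_add₀ (eval_fac_ne g w' q hgq y hy j)]
      rw [hz, ha' j, zpow_zero]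
    rw [Finset.prod_congr rfl (fun j _ => h2 j), Finset.prod_const_one, mul_one]
  let W : Set (En n) := U ∩ φ ⁻¹' Metric.ball 0 δ
  have hW : IsOpen W := hL.continuousOn.isOpen_inter_preimage hU Metric.isOpen_ball
  let τ : En n → En n := fun x => ((1 / (δ - ‖φ x‖) : ℝ) : ℂ) • φ x
  have hpos : ∀ x ∈ W, 0 < δ - ‖φ x‖ := by
    intro x hx
    have := hx.2
    rw [Set.mem_preimage, mem_ball_zero_iff] at this
    linarith
  have hτc : ContinuousOn τ W := by
    have hφc : ContinuousOn φ W := hL.continuousOn.mono Set.inter_subset_left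
    refine ContinuousOn.smul (Complex.continuous_ofReal.comp_continuousOn ?_) hφc
    exact continuousOn_const.div (continuousOn_const.sub hφc.norm) (fun x hx => (hpos x hx).ne')
  have hτ : ∀ x ∈ W, ρ (τ x) • τ x = φ x := by
    intro x hx
    have h1 := hpos x hx
    have h2 : ‖τ x‖ = ‖φ x‖ / (δ - ‖φ x‖) := by
      simp only [τ]
      rw [norm_smul, Complex.norm_real, Real.norm_eq_abs, abs_of_pos (by positivity)]
      ring
    simp only [ρ]
    rw [h2]
    simp only [τ]
    rw [smul_smul, ← Complex.ofReal_mul]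
    have h3 : δ / (1 + ‖φ x‖ / (δ - ‖φ x‖)) * (1 / (δ - ‖φ x‖)) = 1 := by
      have h4 : 1 + ‖φ x‖ / (δ - ‖φ x‖) = δ / (δ - ‖φ x‖) := by
        field_simp
        ring
      rw [h4]
      field_simp
    rw [h3, Complex.ofReal_one, one_smul]
  have hτg : ∀ x ∈ W, MvPolynomial.eval (x : Fin n → ℂ) f ≠ 0 →
      MvPolynomial.eval (τ x : Fin n → ℂ) g ≠ 0 := by
    intro x hx h
    simp only [τ]
    rw [WithLp.ofLp_smul, eval_smul_hom g _ hghom]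
    refine mul_ne_zero (pow_ne_zero _ (Complex.ofReal_ne_zero.2 ?_)) (hfg x hx.1 h)
    have := hpos x hx
    positivity
  ext i
  refine indep f w p _ hfhom hfsf hp hw hfp (T ⁻¹' W) (hW.preimage hT) ?_ a
    (fun x => ∑ i, a i * k i (τ (T x) : Fin n → ℂ)) ?_ ?_ i
  · show T 0 ∈ W
    have : T 0 = 0 := rfl
    rw [this]
    refine ⟨h0U, ?_⟩
    rw [Set.mem_preimage, hφ0]
    exact Metric.mem_ball_self hδ
  · apply continuousOn_finsetSum
    intro i _
    apply continuousOn_const.mul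
    refine (hk i).comp (t := {x | MvPolynomial.eval x g ≠ 0})
      (f := fun x => (τ (T x) : Fin n → ℂ)) ?_ ?_
    · exact hTo.comp_continuousOn (hτc.comp hT.continuousOn (fun x hx => hx.1))
    · intro x hx
      exact hτg (T x) hx.1 hx.2
  · intro x hx h
    rw [← hexp _ (hτg (T x) hx h)]
    apply Finset.prod_congr rfl
    intro j _
    have : u j (τ (T x) : Fin n → ℂ) = MvPolynomial.eval x (p j) := by
      show MvPolynomial.eval (ψ (ρ (τ (T x)) • τ (T x)) : Fin n → ℂ) (p j) = _
      rw [hτ _ hx, hl hx.1]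
    rw [this]

lemma bilip_symm {n : ℕ} (X Y : Set (En n)) (h : BiLipGermHomeo X Y) : BiLipGermHomeo Y X := by
  obtain ⟨U, U', φ, ψ, K, hU, hU', h0U, h0U', hφ0, hm, hm', hl, hr, hL, hL', him⟩ := h
  refine ⟨U', U, ψ, φ, K, hU', hU, h0U', h0U, ?_, hm', hm, hr, hl, hL', hL, ?_⟩
  · have := hl h0U
    rwa [hφ0] at this
  · rw [← him, Set.image_image]
    ext x
    constructor
    · rintro ⟨z, hz, rfl⟩
      simpa only [hl hz.2] using hz
    · intro hx
      exact ⟨x, hx, hl hx.2⟩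

end Aux

/-- Theorem: if `f, g` are nonconstant square-free homogeneous polynomials and there
is a bi-Lipschitz homeomorphism `(ℂⁿ, V(f), 0) → (ℂⁿ, V(g), 0)`, then `f` and `g`
have the same number of pairwise non-associated irreducible factors (equivalently,
the cones `V(f)` and `V(g)` have the same number of irreducible components). Since
`f` and `g` are square-free, this number is the length of the multiset of
irreducible factors. -/
theorem bilip_invariance_number_of_irreducible_components
    (n : ℕ) (f g : MvPolynomial (Fin n) ℂ)
    (hfdeg : 0 < f.totalDegree) (hgdeg : 0 < g.totalDegree)
    (hfsf : Squarefree f) (hgsf : Squarefree g)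
    (hfhom : f.IsHomogeneous f.totalDegree) (hghom : g.IsHomogeneous g.totalDegree)
    (hφ : BiLipGermHomeo (pV f) (pV g)) :
    (UniqueFactorizationMonoid.factors f).card =
      (UniqueFactorizationMonoid.factors g).card := by
  exact le_antisymm (card_le_aux n f g hgdeg hfsf hgsf hfhom hghom hφ)
    (card_le_aux n g f hfdeg hgsf hfsf hghom hfhom (bilip_symm _ _ hφ))
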